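/- Let Γ be a finite-dimensional algebra over a field with gldim Γ < ∞ and domdim Γ = d. For 0 ≤ k ≤ d, the k-shifted algebra B_k = End_Γ(T_k)^op satisfies gldim Γ − k ≤ gldim B_k ≤ gldim Γ. Dually, the k-coshifted algebra B^k = End_Γ(C^k)^op satisfies gldim Γ − k ≤ gldim B^k ≤ gldim Γ. -/

import Mathlib

/-!
Formalization of definitions from "Special tilting modules for algebras with positive
dominant dimension" (Pressland–Sauter), together with one of its statements.
-/

open CategoryTheory

noncomputable section
namespace PS

variable {R : Type} [Ring R]

/-- `N` is (isomorphic to) a direct summand of `M`. -/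
def IsSummand (N M : ModuleCat.{0} R) : Prop :=
  ∃ (ι : N →ₗ[R] M) (π : M →ₗ[R] N), π ∘ₗ ι = LinearMap.id

/-- `M` lies in `add X`: it is a direct summand of a finite direct sum of copies of `X`. -/
def MemAdd (X M : ModuleCat.{0} R) : Prop :=
  ∃ n : ℕ, IsSummand M (ModuleCat.of R (Fin n → X))

/-- `M` is projective-injective. -/
def ProjInj (M : ModuleCat.{0} R) : Prop :=
  Module.Projective R M ∧ Module.Injective R M

/-- The regular left module. -/
def reg (R : Type) [Ring R] : ModuleCat.{0} R := ModuleCat.of R R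

/-- A module is basic if no nonzero module `X` has `X ⊕ X` as a direct summand of it
(equivalently, for finite length modules, its indecomposable direct summands are pairwise
non-isomorphic). -/
def IsBasic (M : ModuleCat.{0} R) : Prop :=
  ∀ X : ModuleCat.{0} R, IsSummand (ModuleCat.of R (X × X)) M → Subsingleton X

/-- `P` is a maximal projective-injective direct summand of the regular module. -/
def IsMaxProjInjSummand (P : ModuleCat.{0} R) : Prop :=
  IsSummand P (reg R) ∧ ProjInj P ∧
    ∀ Q : ModuleCat.{0} R, IsSummand Q (reg R) → ProjInj Q → MemAdd P Q

/-- The data `Y 0 → Y 1 → ⋯ → Y n` forms an exact sequence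
`0 → Y 0 → Y 1 → ⋯ → Y n → 0` (with `n ≥ 1` maps; terms beyond `Y n` are ignored). -/
def IsExactSeq (n : ℕ) (Y : ℕ → ModuleCat.{0} R) (f : ∀ i, Y i →ₗ[R] Y (i+1)) : Prop :=
  Function.Injective (f 0) ∧ Function.Surjective (f (n-1)) ∧
    ∀ i, i + 2 ≤ n → Function.Exact (f i) (f (i+1))

/-- The algebra `R` has dominant dimension at least `k`: the regular module has an
injective resolution whose first `k` terms are projective-injective. -/
def DomdimGE (R : Type) [Ring R] (k : ℕ) : Prop :=
  ∃ (Y : ℕ → ModuleCat.{0} R) (g : reg R →ₗ[R] Y 0) (f : ∀ i, Y i →ₗ[R] Y (i+1)),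
    Function.Injective g ∧ Function.Exact g (f 0) ∧
    (∀ i, Function.Exact (f i) (f (i+1))) ∧
    (∀ i, Module.Injective R (Y i)) ∧ (∀ i, i < k → Module.Projective R (Y i))

/-- `domdim R = d`. -/
def DomdimEq (R : Type) [Ring R] (d : ℕ) : Prop :=
  DomdimGE R d ∧ ¬ DomdimGE R (d+1)

/-- The Ext group `Ext^j(M, N)` in the category of `R`-modules. -/
def ext (M N : ModuleCat.{0} R) (j : ℕ) : Type :=
  ((Ext ℤ (ModuleCat.{0} R) j).obj (Opposite.op M)).obj N

/-- `Ext^j(M, N) = 0` (for a single `j`). -/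
def ExtZero (M N : ModuleCat.{0} R) (j : ℕ) : Prop := Subsingleton (ext M N j)

/-- `Ext^j(M, N) = 0` for all `j ≥ 1`. -/
def ExtVanishing (M N : ModuleCat.{0} R) : Prop :=
  ∀ j : ℕ, 1 ≤ j → ExtZero M N j

/-- Projective dimension at most `k`. -/
def PdimLE (k : ℕ) (M : ModuleCat.{0} R) : Prop :=
  ∃ (Y : ℕ → ModuleCat.{0} R) (f : ∀ i, Y i →ₗ[R] Y (i+1)),
    IsExactSeq (k+1) Y f ∧ (∀ i, i ≤ k → Module.Projective R (Y i)) ∧ Y (k+1) = M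

/-- Injective dimension at most `k`. -/
def IdimLE (k : ℕ) (M : ModuleCat.{0} R) : Prop :=
  ∃ (Y : ℕ → ModuleCat.{0} R) (f : ∀ i, Y i →ₗ[R] Y (i+1)),
    IsExactSeq (k+1) Y f ∧ (∀ i, 1 ≤ i → i ≤ k+1 → Module.Injective R (Y i)) ∧ Y 0 = M

/-- `T` is a `k`-tilting module. -/
def IsTilting (k : ℕ) (T : ModuleCat.{0} R) : Prop :=
  Module.Finite R T ∧ PdimLE k T ∧ ExtVanishing T T ∧
    ∃ (Y : ℕ → ModuleCat.{0} R) (f : ∀ i, Y i →ₗ[R] Y (i+1)),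
      IsExactSeq (k+1) Y f ∧ Y 0 = reg R ∧ ∀ i, 1 ≤ i → i ≤ k+1 → MemAdd T (Y i)

/-- `T` is a `P`-special `k`-tilting module: it is `k`-tilting, and there is a coresolution
`0 → R → t_0 → ⋯ → t_k → 0` with all `t_j ∈ add T` and `t_j ∈ add P` for `j ≤ k-1`. -/
def IsSpecialTilting (P : ModuleCat.{0} R) (k : ℕ) (T : ModuleCat.{0} R) : Prop :=
  IsTilting k T ∧
    ∃ (Y : ℕ → ModuleCat.{0} R) (f : ∀ i, Y i →ₗ[R] Y (i+1)),
      IsExactSeq (k+1) Y f ∧ Y 0 = reg R ∧ (∀ i, 1 ≤ i → i ≤ k+1 → MemAdd T (Y i)) ∧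
        (∀ i, 1 ≤ i → i ≤ k → MemAdd P (Y i))

/-- `M ∈ gen_k(X)`: there is an exact sequence `X^k → ⋯ → X^0 → M → 0` with `X^i ∈ add X`. -/
def MemGen (k : ℕ) (X M : ModuleCat.{0} R) : Prop :=
  ∃ (Y : ℕ → ModuleCat.{0} R) (f : ∀ i, Y i →ₗ[R] Y (i+1)),
    (∀ i, i ≤ k → MemAdd X (Y i)) ∧ Y (k+1) = M ∧
    Function.Surjective (f k) ∧ ∀ i, i < k → Function.Exact (f i) (f (i+1))

/-- `M ∈ cogen^k(X)`: there is an exact sequence `0 → M → X_0 → ⋯ → X_k` with `X_i ∈ add X`. -/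
def MemCogen (k : ℕ) (X M : ModuleCat.{0} R) : Prop :=
  ∃ (Y : ℕ → ModuleCat.{0} R) (f : ∀ i, Y i →ₗ[R] Y (i+1)),
    (∀ i, 1 ≤ i → i ≤ k+1 → MemAdd X (Y i)) ∧ Y 0 = M ∧
    Function.Injective (f 0) ∧ ∀ i, i < k → Function.Exact (f i) (f (i+1))

/-- `M ∈ gen_{k-1}(X)`, where `gen_{-1}(X)` is the whole module category. -/
def MemGenShift : ℕ → ModuleCat.{0} R → ModuleCat.{0} R → Prop
  | 0, _X, _M => True
  | (k+1), X, M => MemGen k X M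

/-- `M ∈ cogen^{k-1}(X)`, where `cogen^{-1}(X)` is the whole module category. -/
def MemCogenShift : ℕ → ModuleCat.{0} R → ModuleCat.{0} R → Prop
  | 0, _X, _M => True
  | (k+1), X, M => MemCogen k X M

/-- Global dimension at most `n` (on finitely generated modules). -/
def GldimLE (R : Type) [Ring R] (n : ℕ) : Prop :=
  ∀ M : ModuleCat.{0} R, Module.Finite R M → PdimLE n M

/-- Global dimension exactly `n`. -/
def GldimEq (R : Type) [Ring R] (n : ℕ) : Prop :=
  GldimLE R n ∧ ∀ m : ℕ, GldimLE R m → n ≤ m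

section Duality

variable (K : Type) [Field K]

section DualDefs
variable (S M : Type) [Semiring S] [AddCommGroup M] [Module K M]

/-- The action of `s : S` as a `K`-linear endomorphism. -/
def actMap [Module S M] [SMulCommClass S K M] (s : S) : M →ₗ[K] M where
  toFun m := s • m
  map_add' := smul_add s
  map_smul' c m := (smul_comm s c m)

/-- The `K`-linear dual of a left `S`-module is a left `Sᵐᵒᵖ`-module (i.e. a right
`S`-module), by precomposition. -/
def dualModuleOp [Module S M] [SMulCommClass S K M] : Module Sᵐᵒᵖ (M →ₗ[K] K) where
  smul s φ := φ ∘ₗ actMap K S M s.unop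
  one_smul φ := by ext m; exact congrArg φ (one_smul S m)
  mul_smul s t φ := by ext m; exact congrArg φ (mul_smul t.unop s.unop m)
  smul_zero s := by ext m; rfl
  smul_add s φ ψ := by ext m; rfl
  add_smul s t φ := by
    ext m
    show φ ((s.unop + t.unop) • m) = φ (s.unop • m) + φ (t.unop • m)
    rw [add_smul, map_add]
  zero_smul φ := by
    ext m
    show φ ((0 : S) • m) = 0
    rw [zero_smul, map_zero]

/-- The `K`-linear dual of a right `S`-module is a left `S`-module, by precomposition. -/
def dualModuleUnop [Module Sᵐᵒᵖ M] [SMulCommClass Sᵐᵒᵖ K M] : Module S (M →ₗ[K] K) where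
  smul s φ := φ ∘ₗ actMap K Sᵐᵒᵖ M (MulOpposite.op s)
  one_smul φ := by ext m; exact congrArg φ (one_smul Sᵐᵒᵖ m)
  mul_smul s t φ := by
    ext m
    show φ (MulOpposite.op (s * t) • m) = φ (MulOpposite.op t • MulOpposite.op s • m)
    rw [← mul_smul]
    rfl
  smul_zero s := by ext m; rfl
  smul_add s φ ψ := by ext m; rfl
  add_smul s t φ := by
    ext m
    show φ ((MulOpposite.op s + MulOpposite.op t) • m)
      = φ (MulOpposite.op s • m) + φ (MulOpposite.op t • m)
    rw [add_smul, map_add]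
  zero_smul φ := by
    ext m
    show φ ((0 : Sᵐᵒᵖ) • m) = 0
    rw [zero_smul, map_zero]

end DualDefs

/-- `D R`: the `K`-linear dual of the right regular module, as a left `R`-module. -/
def Dreg (R : Type) [Ring R] [Algebra K R] : ModuleCat.{0} R :=
  letI : Module R (R →ₗ[K] K) := dualModuleUnop K R R
  ModuleCat.of R (R →ₗ[K] K)

variable {R : Type} [Ring R] [Algebra K R]

/-- The `K`-module structure on an `R`-module, via restriction of scalars. -/
def kMod (M : ModuleCat.{0} R) : Module K M := Module.compHom M (algebraMap K R)

theorem kMod_smulCommClass (M : ModuleCat.{0} R) :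
    letI := kMod K M; SMulCommClass R K M := by
  letI := kMod K M
  constructor
  intro r c m
  show r • (algebraMap K R c • m) = algebraMap K R c • (r • m)
  rw [← mul_smul, ← mul_smul, Algebra.commutes]

theorem kMod_end_smulCommClass (M : ModuleCat.{0} R) :
    letI := kMod K M; SMulCommClass (Module.End R M) K M := by
  letI := kMod K M
  constructor
  intro f c m
  show f (algebraMap K R c • m) = algebraMap K R c • f m
  rw [map_smul]

/-- The dual `D T` of a left `R`-module `T`, as a left module over `B = End_R(T)ᵒᵖ`. -/
def DT (T : ModuleCat.{0} R) : ModuleCat.{0} ((Module.End R T)ᵐᵒᵖ) :=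
  letI := kMod K T
  letI := kMod_end_smulCommClass K T
  letI : Module (Module.End R T)ᵐᵒᵖ (T →ₗ[K] K) := dualModuleOp K (Module.End R T) T
  ModuleCat.of _ (T →ₗ[K] K)

/-- `C` is a `k`-cotilting module. -/
def IsCotilting (k : ℕ) (C : ModuleCat.{0} R) : Prop :=
  Module.Finite R C ∧ IdimLE k C ∧ ExtVanishing C C ∧
    ∃ (Y : ℕ → ModuleCat.{0} R) (f : ∀ i, Y i →ₗ[R] Y (i+1)),
      IsExactSeq (k+1) Y f ∧ Y (k+1) = Dreg K R ∧ ∀ i, i ≤ k → MemAdd C (Y i)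

/-- `C` is an `I`-special `k`-cotilting module: it is `k`-cotilting, and there is a resolution
`0 → c^k → ⋯ → c^0 → D R → 0` with all `c^j ∈ add C` and `c^j ∈ add I` for `j ≤ k-1`. -/
def IsSpecialCotilting (I : ModuleCat.{0} R) (k : ℕ) (C : ModuleCat.{0} R) : Prop :=
  IsCotilting K k C ∧
    ∃ (Y : ℕ → ModuleCat.{0} R) (f : ∀ i, Y i →ₗ[R] Y (i+1)),
      IsExactSeq (k+1) Y f ∧ Y (k+1) = Dreg K R ∧ (∀ i, i ≤ k → MemAdd C (Y i)) ∧
        (∀ i, 1 ≤ i → i ≤ k → MemAdd I (Y i))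

/-- `R` is a `d`-Auslander–Gorenstein algebra: `id R ≤ d+1 ≤ domdim R`. -/
def IsAuslanderGorenstein (R : Type) [Ring R] (d : ℕ) : Prop :=
  IdimLE (d+1) (reg R) ∧ DomdimGE R (d+1)

/-- `R` is a `d`-Auslander algebra: `gldim R ≤ d+1 ≤ domdim R`. -/
def IsAuslander (R : Type) [Ring R] (d : ℕ) : Prop :=
  GldimLE R (d+1) ∧ DomdimGE R (d+1)

end Duality

end PS
end

namespace PS

section ExtVanish

open Abelian

/-- A short exact sequence `0 → A → B → C → 0` of modules. -/
structure ShortExactSeq {R : Type} [Ring R] {A B C : Type} [AddCommGroup A] [AddCommGroup B]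
    [AddCommGroup C] [Module R A] [Module R B] [Module R C]
    (f : A →ₗ[R] B) (g : B →ₗ[R] C) : Prop where
  inj : Function.Injective f
  exact : Function.Exact f g
  surj : Function.Surjective g

variable (R : Type) [Ring R]

/-- `Ext^j(M, N) = 0`, in terms of Yoneda `Ext`. -/
def ExtVanish (j : ℕ) (M N : Type) [AddCommGroup M] [Module R M] [AddCommGroup N]
    [Module R N] : Prop :=
  Subsingleton (Abelian.Ext (ModuleCat.of R M) (ModuleCat.of R N) j)

variable {R}
variable {A B C M N X : Type} [AddCommGroup A] [AddCommGroup B] [AddCommGroup C]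
  [AddCommGroup M] [AddCommGroup N] [AddCommGroup X]
  [Module R A] [Module R B] [Module R C] [Module R M] [Module R N] [Module R X]

theorem extVanish_iff {j : ℕ} :
    ExtVanish R j M N ↔
      ∀ x : Abelian.Ext (ModuleCat.of R M) (ModuleCat.of R N) j, x = 0 :=
  ⟨fun h x => h.elim x 0, fun h => ⟨fun x y => by rw [h x, h y]⟩⟩

/-- The short complex of modules attached to a short exact sequence. -/
abbrev ShortExactSeq.complex {f : A →ₗ[R] B} {g : B →ₗ[R] C} (h : ShortExactSeq f g) :
    ShortComplex (ModuleCat.{0} R) :=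
  ShortComplex.mk (ModuleCat.ofHom f) (ModuleCat.ofHom g)
    (by ext x; exact h.exact.apply_apply_eq_zero x)

theorem ShortExactSeq.shortExact {f : A →ₗ[R] B} {g : B →ₗ[R] C} (h : ShortExactSeq f g) :
    h.complex.ShortExact where
  exact := (ShortComplex.ShortExact.moduleCat_exact_iff_function_exact _).2 h.exact
  mono_f := (ModuleCat.mono_iff_injective _).2 h.inj
  epi_g := (ModuleCat.epi_iff_surjective _).2 h.surj

theorem ShortExactSeq.inl_snd (A B : Type) [AddCommGroup A] [AddCommGroup B] [Module R A]
    [Module R B] : ShortExactSeq (LinearMap.inl R A B) (LinearMap.snd R A B) :=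
  ⟨LinearMap.inl_injective, Function.Exact.inl_snd, LinearMap.snd_surjective⟩

namespace ExtVanish

theorem left_of_shortExact {f : A →ₗ[R] B} {g : B →ₗ[R] C} (h : ShortExactSeq f g) {j : ℕ}
    (hB : ExtVanish R j B N) (hC : ExtVanish R (j + 1) C N) : ExtVanish R j A N := by
  rw [extVanish_iff] at *
  intro x
  obtain ⟨y, rfl⟩ := Ext.contravariant_sequence_exact₁ h.shortExact _ x (add_comm 1 j) (hC _)
  rw [hB y, Ext.comp_zero]

theorem right_of_shortExact {f : A →ₗ[R] B} {g : B →ₗ[R] C} (h : ShortExactSeq f g) {j : ℕ}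
    (hA : ExtVanish R j A N) (hB : ExtVanish R (j + 1) B N) : ExtVanish R (j + 1) C N := by
  rw [extVanish_iff] at *
  intro x
  obtain ⟨y, rfl⟩ := Ext.contravariant_sequence_exact₃ h.shortExact _ x (hB _) (add_comm 1 j)
  rw [hA y, Ext.comp_zero]

theorem sub_of_shortExact {f : A →ₗ[R] B} {g : B →ₗ[R] C} (h : ShortExactSeq f g) {j : ℕ}
    (hC : ExtVanish R j M C) (hB : ExtVanish R (j + 1) M B) : ExtVanish R (j + 1) M A := by
  rw [extVanish_iff] at *
  intro x
  obtain ⟨y, rfl⟩ := Ext.covariant_sequence_exact₁ _ h.shortExact x (hB _) rfl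
  rw [hC y, Ext.zero_comp]

theorem quot_of_shortExact {f : A →ₗ[R] B} {g : B →ₗ[R] C} (h : ShortExactSeq f g) {j : ℕ}
    (hB : ExtVanish R j M B) (hA : ExtVanish R (j + 1) M A) : ExtVanish R j M C := by
  rw [extVanish_iff] at *
  intro x
  obtain ⟨y, rfl⟩ := Ext.covariant_sequence_exact₃ _ h.shortExact x rfl (hA _)
  rw [hB y, Ext.zero_comp]

/-- If `Ext¹(C, N) = 0`, maps to `N` extend along a monomorphism with cokernel `C`. -/
theorem exists_extend {f : A →ₗ[R] B} {g : B →ₗ[R] C} (h : ShortExactSeq f g)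
    (hC : ExtVanish R 1 C N) (u : A →ₗ[R] N) : ∃ v : B →ₗ[R] N, v ∘ₗ f = u := by
  rw [extVanish_iff] at hC
  obtain ⟨y, hy⟩ := Ext.contravariant_sequence_exact₁ h.shortExact _
    (Ext.mk₀ (ModuleCat.ofHom u)) rfl (hC _)
  obtain ⟨v, rfl⟩ := Ext.homEquiv₀.symm.surjective y
  rw [Ext.homEquiv₀_symm_apply, Ext.mk₀_comp_mk₀] at hy
  have := (Ext.mk₀_bijective _ _).1 hy
  exact ⟨v.hom, by simpa using congrArg ModuleCat.Hom.hom this⟩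

/-- If `Ext¹(M, A) = 0`, maps from `M` lift along an epimorphism with kernel `A`. -/
theorem exists_lift {f : A →ₗ[R] B} {g : B →ₗ[R] C} (h : ShortExactSeq f g)
    (hA : ExtVanish R 1 M A) (u : M →ₗ[R] C) : ∃ v : M →ₗ[R] B, g ∘ₗ v = u := by
  rw [extVanish_iff] at hA
  obtain ⟨y, hy⟩ := Ext.covariant_sequence_exact₃ _ h.shortExact
    (Ext.mk₀ (ModuleCat.ofHom u)) rfl (hA _)
  obtain ⟨v, rfl⟩ := Ext.homEquiv₀.symm.surjective y
  rw [Ext.homEquiv₀_symm_apply, Ext.mk₀_comp_mk₀] at hy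
  have := (Ext.mk₀_bijective _ _).1 hy
  exact ⟨v.hom, by simpa using congrArg ModuleCat.Hom.hom this⟩

theorem one_of_forall_lift {f : A →ₗ[R] B} {g : B →ₗ[R] C} (h : ShortExactSeq f g)
    (hB : ExtVanish R 1 M B) (H : ∀ u : M →ₗ[R] C, ∃ v : M →ₗ[R] B, g ∘ₗ v = u) :
    ExtVanish R 1 M A := by
  rw [extVanish_iff] at *
  intro x
  obtain ⟨y, rfl⟩ := Ext.covariant_sequence_exact₁ _ h.shortExact x (hB _) rfl
  obtain ⟨u, rfl⟩ := Ext.homEquiv₀.symm.surjective y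
  obtain ⟨v, hv⟩ := H u.hom
  have hu : u = ModuleCat.ofHom v ≫ h.complex.g := by
    ext x
    exact (LinearMap.congr_fun hv x).symm
  rw [Ext.homEquiv₀_symm_apply, hu, ← Ext.mk₀_comp_mk₀,
    Ext.comp_assoc_of_second_deg_zero, h.shortExact.comp_extClass, Ext.comp_zero]

theorem of_projective [Module.Projective R M] (j : ℕ) : ExtVanish R (j + 1) M N :=
  have : Projective (ModuleCat.of R M) := (IsProjective.iff_projective M).1 inferInstance
  Ext.subsingleton_of_projective _ _ _

theorem of_injective (h : Module.Injective R N) (j : ℕ) : ExtVanish R (j + 1) M N :=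
  have : Injective (ModuleCat.of R N) := Module.injective_object_of_injective_module R N
  Ext.subsingleton_of_injective _ _ _

/-- Vanishing in the second variable passes to finite sums of summands. -/
theorem of_sum_eq_id_right {ι : Type} [Fintype ι] {Y : ι → Type}
    [∀ i, AddCommGroup (Y i)] [∀ i, Module R (Y i)]
    (a : ∀ i, N →ₗ[R] Y i) (b : ∀ i, Y i →ₗ[R] N)
    (hab : ∑ i, b i ∘ₗ a i = LinearMap.id) {j : ℕ} (h : ∀ i, ExtVanish R j M (Y i)) :
    ExtVanish R j M N := by
  simp only [extVanish_iff] at *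
  intro x
  have key : (𝟙 (ModuleCat.of R N)) = ∑ i, ModuleCat.ofHom (a i) ≫ ModuleCat.ofHom (b i) := by
    ext n
    simpa using (LinearMap.congr_fun hab n).symm
  rw [← Ext.comp_mk₀_id x, key, Ext.mk₀_sum, Ext.comp_sum]
  refine Finset.sum_eq_zero fun i _ => ?_
  rw [← Ext.mk₀_comp_mk₀, ← Ext.comp_assoc_of_second_deg_zero, h i (x.comp _ _), Ext.zero_comp]

/-- Vanishing in the first variable passes to finite sums of summands. -/
theorem of_sum_eq_id_left {ι : Type} [Fintype ι] {Y : ι → Type}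
    [∀ i, AddCommGroup (Y i)] [∀ i, Module R (Y i)]
    (a : ∀ i, M →ₗ[R] Y i) (b : ∀ i, Y i →ₗ[R] M)
    (hab : ∑ i, b i ∘ₗ a i = LinearMap.id) {j : ℕ} (h : ∀ i, ExtVanish R j (Y i) N) :
    ExtVanish R j M N := by
  simp only [extVanish_iff] at *
  intro x
  have key : (𝟙 (ModuleCat.of R M)) = ∑ i, ModuleCat.ofHom (a i) ≫ ModuleCat.ofHom (b i) := by
    ext n
    simpa using (LinearMap.congr_fun hab n).symm
  rw [← Ext.mk₀_id_comp x, key, Ext.mk₀_sum, Ext.sum_comp]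
  refine Finset.sum_eq_zero fun i _ => ?_
  rw [← Ext.mk₀_comp_mk₀, Ext.comp_assoc_of_second_deg_zero, h i (Ext.comp _ x _), Ext.comp_zero]

theorem congr_right (e : X ≃ₗ[R] N) {j : ℕ} (h : ExtVanish R j M X) : ExtVanish R j M N :=
  of_sum_eq_id_right (ι := Unit) (Y := fun _ => X) (fun _ => e.symm.toLinearMap)
    (fun _ => e.toLinearMap) (by ext; simp) fun _ => h

theorem congr_left (e : X ≃ₗ[R] M) {j : ℕ} (h : ExtVanish R j X N) : ExtVanish R j M N :=
  of_sum_eq_id_left (ι := Unit) (Y := fun _ => X) (fun _ => e.symm.toLinearMap)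
    (fun _ => e.toLinearMap) (by ext; simp) fun _ => h

theorem pi_right {ι : Type} [Finite ι] {Y : ι → Type}
    [∀ i, AddCommGroup (Y i)] [∀ i, Module R (Y i)] {j : ℕ} (h : ∀ i, ExtVanish R j M (Y i)) :
    ExtVanish R j M (∀ i, Y i) := by
  classical
  have := Fintype.ofFinite ι
  exact of_sum_eq_id_right (LinearMap.proj) (LinearMap.single R Y) (by ext; simp) h

theorem pi_left {ι : Type} [Finite ι] {Y : ι → Type}
    [∀ i, AddCommGroup (Y i)] [∀ i, Module R (Y i)] {j : ℕ} (h : ∀ i, ExtVanish R j (Y i) N) :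
    ExtVanish R j (∀ i, Y i) N := by
  classical
  have := Fintype.ofFinite ι
  exact of_sum_eq_id_left (LinearMap.proj) (LinearMap.single R Y) (by ext; simp) h

theorem mid_of_shortExact {f : A →ₗ[R] B} {g : B →ₗ[R] C} (h : ShortExactSeq f g) {j : ℕ}
    (hA : ExtVanish R j M A) (hC : ExtVanish R j M C) : ExtVanish R j M B := by
  rw [extVanish_iff] at *
  intro x
  obtain ⟨y, rfl⟩ := Ext.covariant_sequence_exact₂ _ h.shortExact x (hC _)
  rw [hA y, Ext.zero_comp]

theorem mid_left_of_shortExact {f : A →ₗ[R] B} {g : B →ₗ[R] C} (h : ShortExactSeq f g) {j : ℕ}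
    (hA : ExtVanish R j A N) (hC : ExtVanish R j C N) : ExtVanish R j B N := by
  rw [extVanish_iff] at *
  intro x
  obtain ⟨y, rfl⟩ := Ext.contravariant_sequence_exact₂ h.shortExact _ x (hA _)
  rw [hC y, Ext.comp_zero]

theorem prod_right {j : ℕ} (h₁ : ExtVanish R j M A) (h₂ : ExtVanish R j M B) :
    ExtVanish R j M (A × B) :=
  mid_of_shortExact (ShortExactSeq.inl_snd A B) h₁ h₂

theorem prod_left {j : ℕ} (h₁ : ExtVanish R j A N) (h₂ : ExtVanish R j B N) :
    ExtVanish R j (A × B) N :=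
  mid_left_of_shortExact (ShortExactSeq.inl_snd A B) h₁ h₂

theorem of_memAdd_right {P Q : ModuleCat.{0} R} (hQ : MemAdd P Q) {j : ℕ}
    (h : ExtVanish R j M P) : ExtVanish R j M Q := by
  obtain ⟨n, ι, π, hπ⟩ := hQ
  refine of_sum_eq_id_right (ι := Unit) (Y := fun _ => Fin n → P) (fun _ => ι) (fun _ => π) ?_
    fun _ => pi_right fun _ => h
  simpa using hπ

theorem of_memAdd_left {P Q : ModuleCat.{0} R} (hQ : MemAdd P Q) {j : ℕ}
    (h : ExtVanish R j P N) : ExtVanish R j Q N := by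
  obtain ⟨n, ι, π, hπ⟩ := hQ
  refine of_sum_eq_id_left (ι := Unit) (Y := fun _ => Fin n → P) (fun _ => ι) (fun _ => π) ?_
    fun _ => pi_left fun _ => h
  simpa using hπ

end ExtVanish

open Limits in
theorem extVanish_of_extZero {P Q : ModuleCat.{0} R} {j : ℕ} (h : ExtZero P Q (j + 1)) :
    ExtVanish R (j + 1) P Q := by
  rw [extVanish_iff]
  intro x
  let S := ProjectiveResolution.of P
  obtain ⟨f, hf, rfl⟩ := S.extMk_surjective x (j + 2) rfl
  rw [S.extMk_eq_zero_iff f _ _ hf j rfl]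
  have hz : IsZero ((S.complex.linearYonedaObj ℤ Q).homology (j + 1)) := by
    refine IsZero.of_iso ?_ (S.isoExt (R := ℤ) (j + 1) Q).symm
    have : Subsingleton (((Ext ℤ (ModuleCat.{0} R) (j + 1)).obj (Opposite.op P)).obj Q) := h
    exact ModuleCat.isZero_of_subsingleton _
  rw [← HomologicalComplex.exactAt_iff_isZero_homology,
    HomologicalComplex.exactAt_iff' _ j (j + 1) (j + 2) (by simp) (by simp),
    ShortComplex.moduleCat_exact_iff] at hz
  obtain ⟨g, hg⟩ := hz f hf
  exact ⟨g, hg⟩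

end ExtVanish

section Sequences

variable {R : Type} [Ring R]

/-- `SeqOf 𝒳 k A M`: there is an exact sequence `0 → A → t₁ → ⋯ → t_k → M → 0` all of whose
middle terms satisfy `𝒳`. -/
def SeqOf (𝒳 : ModuleCat.{0} R → Prop) : ℕ → ModuleCat.{0} R → ModuleCat.{0} R → Prop
  | 0, A, M => Nonempty (A ≃ₗ[R] M)
  | k + 1, A, M => ∃ (t A' : ModuleCat.{0} R) (f : A →ₗ[R] t) (g : t →ₗ[R] A'),
      𝒳 t ∧ ShortExactSeq f g ∧ SeqOf 𝒳 k A' M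

variable {𝒳 𝒵 : ModuleCat.{0} R → Prop}

theorem ShortExactSeq.comp_equiv {A A₁ B C : Type} [AddCommGroup A] [AddCommGroup A₁]
    [AddCommGroup B] [AddCommGroup C] [Module R A] [Module R A₁] [Module R B] [Module R C]
    {f : A →ₗ[R] B} {g : B →ₗ[R] C} (h : ShortExactSeq f g) (e : A₁ ≃ₗ[R] A) :
    ShortExactSeq (f ∘ₗ e.toLinearMap) g where
  inj := h.inj.comp e.injective
  exact := by
    intro y
    rw [h.exact y]
    simp [e.surjective.exists]
  surj := h.surj

theorem ShortExactSeq.ker {B C : Type} [AddCommGroup B] [AddCommGroup C] [Module R B]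
    [Module R C] {g : B →ₗ[R] C} (h : Function.Surjective g) :
    ShortExactSeq (LinearMap.ker g).subtype g where
  inj := Subtype.val_injective
  exact := LinearMap.exact_subtype_ker_map g
  surj := h

theorem SeqOf.congr_left {k : ℕ} {A A₁ M : ModuleCat.{0} R} (e : A₁ ≃ₗ[R] A)
    (h : SeqOf 𝒳 k A M) : SeqOf 𝒳 k A₁ M := by
  cases k with
  | zero => exact h.map e.trans
  | succ k =>
    obtain ⟨t, A', f, g, ht, hfg, h'⟩ := h
    exact ⟨t, A', _, g, ht, hfg.comp_equiv e, h'⟩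

theorem SeqOf.mono {k : ℕ} {A M : ModuleCat.{0} R} (hPQ : ∀ X, 𝒳 X → 𝒵 X)
    (h : SeqOf 𝒳 k A M) : SeqOf 𝒵 k A M := by
  induction k generalizing A with
  | zero => exact h
  | succ k ih =>
    obtain ⟨t, A', f, g, ht, hfg, h'⟩ := h
    exact ⟨t, A', f, g, hPQ _ ht, hfg, ih h'⟩

theorem SeqOf.snoc {k : ℕ} {A M t N : ModuleCat.{0} R} (h : SeqOf 𝒳 k A M) (ht : 𝒳 t)
    {f : M →ₗ[R] t} {g : t →ₗ[R] N} (hfg : ShortExactSeq f g) : SeqOf 𝒳 (k + 1) A N := by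
  induction k generalizing A with
  | zero =>
    obtain ⟨e⟩ := h
    exact ⟨t, N, _, g, ht, hfg.comp_equiv e, ⟨LinearEquiv.refl R N⟩⟩
  | succ k ih =>
    obtain ⟨t', A', f', g', ht', hfg', h'⟩ := h
    exact ⟨t', A', f', g', ht', hfg', ih h'⟩

theorem seqOf_of_isExactSeq {k : ℕ} {Y : ℕ → ModuleCat.{0} R} {f : ∀ i, Y i →ₗ[R] Y (i + 1)}
    (h : IsExactSeq (k + 1) Y f) (hY : ∀ i, 1 ≤ i → i ≤ k → 𝒳 (Y i)) :
    SeqOf 𝒳 k (Y 0) (Y (k + 1)) := by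
  obtain ⟨hinj, hsurj, hex⟩ := h
  have key : ∀ m i, i + m = k →
      SeqOf 𝒳 m (ModuleCat.of R (LinearMap.range (f i))) (Y (k + 1)) := by
    intro m
    induction m with
    | zero =>
      rintro i rfl
      exact ⟨LinearEquiv.ofTop _ (LinearMap.range_eq_top.2 hsurj)⟩
    | succ m ih =>
      intro i hi
      refine ⟨Y (i + 1), ModuleCat.of R (LinearMap.range (f (i + 1))),
        (LinearMap.range (f i)).subtype, (f (i + 1)).rangeRestrict, hY _ (by omega) (by omega),
        ⟨Subtype.val_injective, ?_, LinearMap.surjective_rangeRestrict _⟩, ih (i + 1) (by omega)⟩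
      intro y
      rw [← Submodule.coe_eq_zero]
      refine (hex i (by omega) y).trans ?_
      simp
  exact (key k 0 (by omega)).congr_left (LinearEquiv.ofInjective (f 0) hinj)

/-- Prepend a module to a sequence of modules. -/
def consMod (A : ModuleCat.{0} R) (Z : ℕ → ModuleCat.{0} R) : ℕ → ModuleCat.{0} R
  | 0 => A
  | i + 1 => Z i

/-- Prepend a map to a sequence of maps. -/
def consMap {A : ModuleCat.{0} R} {Z : ℕ → ModuleCat.{0} R} (g : A →ₗ[R] Z 0)
    (f : ∀ i, Z i →ₗ[R] Z (i + 1)) : ∀ i, consMod A Z i →ₗ[R] consMod A Z (i + 1)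
  | 0 => g
  | i + 1 => f i

theorem SeqOf.exists_isExactSeq {k : ℕ} {A M : ModuleCat.{0} R} (h : SeqOf 𝒳 k A M) :
    ∃ (Z : ℕ → ModuleCat.{0} R) (g : A →ₗ[R] Z 0) (f : ∀ i, Z i →ₗ[R] Z (i + 1)),
      IsExactSeq (k + 1) (consMod A Z) (consMap g f) ∧ Z k = M ∧ ∀ i, i < k → 𝒳 (Z i) := by
  induction k generalizing A with
  | zero =>
    obtain ⟨e⟩ := h
    exact ⟨fun _ => M, e.toLinearMap, fun _ => 0,
      ⟨e.injective, e.surjective, fun i hi => by omega⟩, rfl, fun i hi => by omega⟩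
  | succ k ih =>
    obtain ⟨t, A', f', g', ht, hfg, h'⟩ := h
    obtain ⟨Z, g, f, ⟨hinj, hsurj, hex⟩, hZ, hP⟩ := ih h'
    refine ⟨consMod t Z, f', consMap (A := t) (g ∘ₗ g') f, ⟨hfg.inj, ?_, ?_⟩, hZ, ?_⟩
    · cases k with
      | zero => exact hsurj.comp hfg.surj
      | succ k => exact hsurj
    · intro i hi
      rcases i with _ | _ | i
      · intro y
        refine Iff.trans ?_ (hfg.exact y)
        exact map_eq_zero_iff g hinj
      · intro y
        refine Iff.trans (hex 0 (by omega) y) ?_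
        exact hfg.surj.exists
      · exact hex (i + 1) (by omega)
    · intro i hi
      cases i with
      | zero => exact ht
      | succ i => exact hP i (by omega)

theorem pdimLE_iff {k : ℕ} {M : ModuleCat.{0} R} :
    PdimLE k M ↔ ∃ A : ModuleCat.{0} R, Module.Projective R A ∧
      SeqOf (fun X => Module.Projective R X) k A M := by
  constructor
  · rintro ⟨Y, f, h, hY, rfl⟩
    exact ⟨Y 0, hY 0 (by omega), seqOf_of_isExactSeq h fun i _ hi => hY i hi⟩
  · rintro ⟨A, hA, h⟩
    obtain ⟨Z, g, f, hex, rfl, hP⟩ := h.exists_isExactSeq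
    refine ⟨consMod A Z, consMap g f, hex, fun i hi => ?_, rfl⟩
    cases i with
    | zero => exact hA
    | succ i => exact hP i (by omega)

theorem SeqOf.extVanish_left {M N : ModuleCat.{0} R} {k j : ℕ} {A : ModuleCat.{0} R}
    (h : SeqOf 𝒳 k A M) (h𝒳 : ∀ t, 𝒳 t → ∀ i, j < i → ExtVanish R (i + 1) t N)
    (hA : ExtVanish R (j + 1) A N) : ExtVanish R (j + k + 1) M N := by
  induction k generalizing A j with
  | zero =>
    obtain ⟨e⟩ := h
    exact ExtVanish.congr_left e hA
  | succ k ih =>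
    obtain ⟨t, A', f, g, ht, hfg, h'⟩ := h
    have := ih (j := j + 1) h' (fun t ht i hi => h𝒳 t ht i (by omega))
      (ExtVanish.right_of_shortExact hfg hA (h𝒳 t ht (j + 1) (by omega)))
    rwa [show j + (k + 1) + 1 = j + 1 + k + 1 by omega]

theorem SeqOf.extVanish_right {M N : ModuleCat.{0} R} {k j : ℕ} {A : ModuleCat.{0} R}
    (h : SeqOf 𝒳 k A M) (h𝒳 : ∀ t, 𝒳 t → ∀ i, ExtVanish R (i + 1) N t)
    (hA : ExtVanish R (j + k + 1) N A) : ExtVanish R (j + 1) N M := by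
  induction k generalizing A with
  | zero =>
    obtain ⟨e⟩ := h
    exact ExtVanish.congr_right e hA
  | succ k ih =>
    obtain ⟨t, A', f, g, ht, hfg, h'⟩ := h
    exact ih h' (ExtVanish.quot_of_shortExact hfg (h𝒳 t ht (j + k)) hA)

/-- If all middle terms and the last term have no higher extensions by `N`, neither has the
first term. -/
theorem SeqOf.extVanish_first {M N : ModuleCat.{0} R} {k : ℕ} {A : ModuleCat.{0} R}
    (h : SeqOf 𝒳 k A M) (h𝒳 : ∀ t, 𝒳 t → ∀ i, ExtVanish R (i + 1) t N)
    (hM : ∀ i, ExtVanish R (i + 1) M N) (i : ℕ) : ExtVanish R (i + 1) A N := by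
  induction k generalizing A i with
  | zero =>
    obtain ⟨e⟩ := h
    exact ExtVanish.congr_left e.symm (hM i)
  | succ k ih =>
    obtain ⟨t, A', f, g, ht, hfg, h'⟩ := h
    exact ExtVanish.left_of_shortExact hfg (h𝒳 t ht i) (ih h' (i + 1))

theorem SeqOf.extVanish_last_of_right {M N : ModuleCat.{0} R} {k j : ℕ} {A : ModuleCat.{0} R}
    (h : SeqOf 𝒳 k A M) (h𝒳 : ∀ t, 𝒳 t → ∀ i, ExtVanish R (i + 1) N t)
    (hM : ExtVanish R (j + 1) N M) : ExtVanish R (j + k + 1) N A := by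
  induction k generalizing A with
  | zero =>
    obtain ⟨e⟩ := h
    exact ExtVanish.congr_right e.symm hM
  | succ k ih =>
    obtain ⟨t, A', f, g, ht, hfg, h'⟩ := h
    exact ExtVanish.sub_of_shortExact hfg (ih h') (h𝒳 t ht _)

theorem PdimLE.extVanish {k : ℕ} {M : ModuleCat.{0} R} (h : PdimLE k M) (N : ModuleCat.{0} R)
    {j : ℕ} (hj : k < j) : ExtVanish R j M N := by
  obtain ⟨A, hA, h⟩ := pdimLE_iff.1 h
  obtain ⟨i, rfl⟩ : ∃ i, j = i + k + 1 := ⟨j - k - 1, by omega⟩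
  exact h.extVanish_left (fun t ht i _ => ExtVanish.of_projective i) (ExtVanish.of_projective i)

theorem IdimLE.extVanish {k : ℕ} {M : ModuleCat.{0} R} (h : IdimLE k M) (N : ModuleCat.{0} R)
    {j : ℕ} (hj : k < j) : ExtVanish R j N M := by
  obtain ⟨Y, f, h, hY, rfl⟩ := h
  obtain ⟨i, rfl⟩ : ∃ i, j = i + k + 1 := ⟨j - k - 1, by omega⟩
  exact (seqOf_of_isExactSeq (𝒳 := fun X => Module.Injective R X) h
    fun i h1 h2 => hY i h1 (by omega)).extVanish_last_of_right
    (fun t ht i => ExtVanish.of_injective ht i)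
    (ExtVanish.of_injective (hY (k + 1) (by omega) le_rfl) i)

theorem exists_free_cover (M : Type) [AddCommGroup M] [Module R M] [Module.Finite R M] :
    ∃ (n : ℕ) (p : (Fin n → R) →ₗ[R] M), Function.Surjective p :=
  Module.Finite.exists_fin' R M

theorem projective_of_extVanish [IsNoetherianRing R] (M : Type) [AddCommGroup M] [Module R M]
    [Module.Finite R M]
    (h : ∀ N : ModuleCat.{0} R, Module.Finite R N → ExtVanish R 1 M N) :
    Module.Projective R M := by
  obtain ⟨n, p, hp⟩ := exists_free_cover (R := R) M
  have hfin : Module.Finite R (LinearMap.ker p) := inferInstance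
  obtain ⟨s, hs⟩ := ExtVanish.exists_lift (ShortExactSeq.ker hp)
    (h (ModuleCat.of R (LinearMap.ker p)) hfin) LinearMap.id
  exact Module.Projective.of_split s p hs

theorem pdimLE_of_extVanish [IsNoetherianRing R] {k : ℕ} {M : ModuleCat.{0} R}
    (hM : Module.Finite R M)
    (h : ∀ N : ModuleCat.{0} R, Module.Finite R N → ExtVanish R (k + 1) M N) : PdimLE k M := by
  rw [pdimLE_iff]
  induction k generalizing M with
  | zero => exact ⟨M, projective_of_extVanish M h, ⟨LinearEquiv.refl R M⟩⟩
  | succ k ih =>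
    obtain ⟨n, p, hp⟩ := exists_free_cover (R := R) M
    have hfin : Module.Finite R (LinearMap.ker p) := inferInstance
    obtain ⟨A, hA, hs⟩ := ih (M := ModuleCat.of R (LinearMap.ker p)) hfin fun N hN =>
      ExtVanish.left_of_shortExact (ShortExactSeq.ker hp) (ExtVanish.of_projective k) (h N hN)
    exact ⟨A, hA, hs.snoc (t := ModuleCat.of R (Fin n → R))
      (inferInstance : Module.Projective R (Fin n → R)) (ShortExactSeq.ker hp)⟩

theorem gldimLE_iff [IsNoetherianRing R] {n : ℕ} :
    GldimLE R n ↔ ∀ M N : ModuleCat.{0} R, Module.Finite R M → Module.Finite R N →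
      ExtVanish R (n + 1) M N :=
  ⟨fun h M N hM _ => (h M hM).extVanish N (Nat.lt_succ_self n),
    fun h M hM => pdimLE_of_extVanish hM fun N hN => h M N hM hN⟩

theorem memAdd_iff {X M : ModuleCat.{0} R} :
    MemAdd X M ↔ ∃ (n : ℕ) (a : Fin n → (M →ₗ[R] X)) (b : Fin n → (X →ₗ[R] M)),
      ∑ i, b i ∘ₗ a i = LinearMap.id := by
  constructor
  · rintro ⟨n, ι, π, h⟩
    refine ⟨n, fun i => LinearMap.proj i ∘ₗ ι,
      fun i => π ∘ₗ LinearMap.single R (fun _ : Fin n => (X : Type)) i, ?_⟩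
    ext m
    have : ∑ i, Pi.single i ((ι m : Fin n → X) i) = (ι m : Fin n → X) :=
      Finset.univ_sum_single (ι m : Fin n → X)
    have h2 := congrArg π this
    rw [map_sum] at h2
    simpa [LinearMap.sum_apply] using h2.trans (LinearMap.congr_fun h m)
  · rintro ⟨n, a, b, h⟩
    refine ⟨n, LinearMap.pi a, ∑ i, b i ∘ₗ LinearMap.proj i, ?_⟩
    ext m
    simpa [LinearMap.sum_apply] using LinearMap.congr_fun h m

theorem MemAdd.refl (X : ModuleCat.{0} R) : MemAdd X X :=
  memAdd_iff.2 ⟨1, fun _ => LinearMap.id, fun _ => LinearMap.id, by ext; simp⟩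

theorem MemAdd.of_summand {X M N : ModuleCat.{0} R} (h : MemAdd X M) (hN : IsSummand N M) :
    MemAdd X N := by
  obtain ⟨n, ι, π, h⟩ := h
  obtain ⟨ι', π', h'⟩ := hN
  refine ⟨n, ι ∘ₗ ι', π' ∘ₗ π, ?_⟩
  rw [LinearMap.comp_assoc, ← LinearMap.comp_assoc ι', h, LinearMap.id_comp, h']

theorem MemAdd.finite {X M : ModuleCat.{0} R} (h : MemAdd X M) (hX : Module.Finite R X) :
    Module.Finite R M := by
  obtain ⟨n, ι, π, h⟩ := h
  exact Module.Finite.of_surjective π fun m => ⟨ι m, LinearMap.congr_fun h m⟩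

theorem IsSummand.projective {M N : ModuleCat.{0} R} (hM : Module.Projective R M)
    (h : IsSummand N M) : Module.Projective R N := by
  obtain ⟨ι, π, h⟩ := h
  exact Module.Projective.of_split ι π h

theorem IsSummand.injective {M N : ModuleCat.{0} R} (hM : Module.Injective R M)
    (h : IsSummand N M) : Module.Injective R N := by
  obtain ⟨ι, π, h⟩ := h
  refine ⟨fun X Y _ _ _ _ f hf g => ?_⟩
  obtain ⟨u, hu⟩ := hM.out f hf (ι ∘ₗ g)
  refine ⟨π ∘ₗ u, fun x => ?_⟩
  have := LinearMap.congr_fun h (g x)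
  simpa [hu] using this

theorem IsSummand.projInj {M N : ModuleCat.{0} R} (hM : ProjInj M) (h : IsSummand N M) :
    ProjInj N :=
  ⟨h.projective hM.1, h.injective hM.2⟩

theorem injective_pi {X : ModuleCat.{0} R} (hX : Module.Injective R X) (n : ℕ) :
    Module.Injective R (Fin n → X) := by
  refine ⟨fun Y Z _ _ _ _ f hf g => ?_⟩
  choose u hu using fun i => hX.out f hf (LinearMap.proj i ∘ₗ g)
  exact ⟨LinearMap.pi u, fun x => funext fun i => hu i x⟩

theorem MemAdd.projInj {X M : ModuleCat.{0} R} (hX : ProjInj X) (h : MemAdd X M) :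
    ProjInj M := by
  obtain ⟨n, h⟩ := h
  have := hX.1
  exact h.projInj ⟨Module.Projective.of_equiv
    (DFinsupp.linearEquivFunOnFintype (R := R) (M := fun _ : Fin n => (X : Type))),
    injective_pi hX.2 n⟩

end Sequences

section Approximation

theorem isScalarTower_compHom (K : Type) [Field K] (Γ : Type) [Ring Γ] [Algebra K Γ] (M : Type)
    [AddCommGroup M] [Module Γ M] :
    letI : Module K M := Module.compHom M (algebraMap K Γ)
    IsScalarTower K Γ M :=
  letI : Module K M := Module.compHom M (algebraMap K Γ)
  IsScalarTower.of_algebraMap_smul fun _ _ => rfl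

variable {Γ : Type} [Ring Γ]

/-- For finitely generated modules over a finite-dimensional algebra, there is a map `T^r → M`
through which every map `T → M` factors. -/
theorem exists_cover (K : Type) [Field K] [Algebra K Γ] [FiniteDimensional K Γ]
    (T M : Type) [AddCommGroup T] [AddCommGroup M] [Module Γ T] [Module Γ M]
    [Module.Finite Γ T] [Module.Finite Γ M] :
    ∃ (r : ℕ) (p : (Fin r → T) →ₗ[Γ] M),
      ∀ h : T →ₗ[Γ] M, ∃ h' : T →ₗ[Γ] (Fin r → T), p ∘ₗ h' = h := by
  let : Module K T := Module.compHom T (algebraMap K Γ)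
  let : Module K M := Module.compHom M (algebraMap K Γ)
  have : IsScalarTower K Γ T := isScalarTower_compHom K Γ T
  have : IsScalarTower K Γ M := isScalarTower_compHom K Γ M
  have : Module.Finite K T := Module.Finite.trans Γ T
  have : Module.Finite K M := Module.Finite.trans Γ M
  have : SMulCommClass Γ K M := IsScalarTower.to_smulCommClass'
  have : SMulCommClass Γ K T := IsScalarTower.to_smulCommClass'
  have : Module.Finite K (T →ₗ[Γ] M) :=
    Module.Finite.of_injective (LinearMap.restrictScalarsₗ K Γ T M K)
      (LinearMap.restrictScalars_injective K)
  obtain ⟨r, s, hs⟩ := Module.Finite.exists_fin (R := K) (M := T →ₗ[Γ] M)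
  refine ⟨r, ∑ i, s i ∘ₗ LinearMap.proj i, fun h => ?_⟩
  have hh : h ∈ Submodule.span K (Set.range s) := hs ▸ Submodule.mem_top
  obtain ⟨c, rfl⟩ := (Submodule.mem_span_range_iff_exists_fun K).1 hh
  refine ⟨LinearMap.pi fun i => c i • LinearMap.id, ?_⟩
  ext x
  simp only [LinearMap.comp_apply, LinearMap.sum_apply, LinearMap.proj_apply,
    LinearMap.pi_apply, LinearMap.smul_apply, LinearMap.id_apply]
  refine Finset.sum_congr rfl fun i _ => ?_
  rw [LinearMap.map_smul_of_tower]

theorem exists_mem_range_of_seqOf {T t M : ModuleCat.{0} Γ} {k : ℕ}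
    (ht : MemAdd T t) (hs : SeqOf (MemAdd T) k (reg Γ) t)
    (hTM : ∀ i, ExtVanish Γ (i + 1) T M) (x : M) :
    ∃ (n : ℕ) (q : (Fin n → T) →ₗ[Γ] M), x ∈ LinearMap.range q := by
  let u : reg Γ →ₗ[Γ] M := LinearMap.toSpanSingleton Γ M x
  have hu : u (1 : Γ) = x := LinearMap.toSpanSingleton_apply_one Γ M x
  suffices h : ∃ (t' : ModuleCat.{0} Γ) (f : reg Γ →ₗ[Γ] t') (v : t' →ₗ[Γ] M),
      MemAdd T t' ∧ v ∘ₗ f = u by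
    obtain ⟨t', f, v, ⟨n, ι, π, hπ⟩, hv⟩ := h
    refine ⟨n, v ∘ₗ π, ι (f (1 : Γ)), ?_⟩
    have h1 := LinearMap.congr_fun hπ (f (1 : Γ))
    have h2 := LinearMap.congr_fun hv (1 : Γ)
    simp only [LinearMap.comp_apply, LinearMap.id_apply] at h1 h2
    rw [LinearMap.comp_apply, h1]
    exact h2.trans hu
  cases k with
  | zero =>
    obtain ⟨e⟩ := hs
    exact ⟨t, e.toLinearMap, u ∘ₗ e.symm.toLinearMap, ht,
      LinearMap.ext fun x => congrArg u (e.symm_apply_apply x)⟩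
  | succ k =>
    obtain ⟨t', A', f, g, ht', hfg, h'⟩ := hs
    obtain ⟨v, hv⟩ := ExtVanish.exists_extend hfg
      (h'.extVanish_first (fun t ht i => ExtVanish.of_memAdd_left ht (hTM i))
        (fun i => ExtVanish.of_memAdd_left ht (hTM i)) 0) u
    exact ⟨t', f, v, ht', hv⟩

/-- Modules in the perpendicular category of a tilting module `T` admit exact `add T`-covers. -/
theorem exists_perp_cover (K : Type) [Field K] [Algebra K Γ] [FiniteDimensional K Γ]
    {T t : ModuleCat.{0} Γ} {k : ℕ} (hfin : Module.Finite Γ T)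
    (hTT : ∀ i, ExtVanish Γ (i + 1) T T) (ht : MemAdd T t)
    (hs : SeqOf (MemAdd T) k (reg Γ) t) (M : ModuleCat.{0} Γ) (hM : Module.Finite Γ M)
    (hTM : ∀ i, ExtVanish Γ (i + 1) T M) :
    ∃ (r : ℕ) (N : ModuleCat.{0} Γ) (f : N →ₗ[Γ] (Fin r → T)) (p : (Fin r → T) →ₗ[Γ] M),
      ShortExactSeq f p ∧ Module.Finite Γ N ∧ (∀ i, ExtVanish Γ (i + 1) T N) ∧
      ∀ h : T →ₗ[Γ] M, ∃ h' : T →ₗ[Γ] (Fin r → T), p ∘ₗ h' = h := by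
  obtain ⟨r, p, hp⟩ := exists_cover K (Γ := Γ) T M
  have hsurj : Function.Surjective p := by
    intro x
    obtain ⟨n, q, y, rfl⟩ := exists_mem_range_of_seqOf ht hs hTM x
    choose h' hh' using fun i : Fin n => hp (q ∘ₗ LinearMap.single Γ (fun _ => (T : Type)) i)
    refine ⟨∑ i, h' i (y i), ?_⟩
    rw [map_sum]
    conv_rhs => rw [← Finset.univ_sum_single y, map_sum]
    exact Finset.sum_congr rfl fun i _ => LinearMap.congr_fun (hh' i) (y i)
  have : IsNoetherianRing Γ := IsNoetherianRing.of_finite K Γ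
  have hses := ShortExactSeq.ker hsurj
  refine ⟨r, ModuleCat.of Γ (LinearMap.ker p), (LinearMap.ker p).subtype, p, hses,
    (inferInstance : Module.Finite Γ (LinearMap.ker p)), fun i => ?_, hp⟩
  cases i with
  | zero => exact ExtVanish.one_of_forall_lift hses (ExtVanish.pi_right fun _ => hTT 0) hp
  | succ i =>
    exact ExtVanish.sub_of_shortExact hses (hTM i) (ExtVanish.pi_right fun _ => hTT (i + 1))

/-- Modules `X` with `Ext(X, T) = 0` and finite projective dimension have no extensions by
modules in the perpendicular category of `T`. -/
theorem extVanish_perp (K : Type) [Field K] [Algebra K Γ] [FiniteDimensional K Γ]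
    {T t X : ModuleCat.{0} Γ} {k n : ℕ} (hfin : Module.Finite Γ T)
    (hTT : ∀ i, ExtVanish Γ (i + 1) T T) (ht : MemAdd T t)
    (hs : SeqOf (MemAdd T) k (reg Γ) t) (hX : PdimLE n X)
    (hXT : ∀ i, ExtVanish Γ (i + 1) X T) (M : ModuleCat.{0} Γ) (hM : Module.Finite Γ M)
    (hTM : ∀ i, ExtVanish Γ (i + 1) T M) (j : ℕ) : ExtVanish Γ (j + 1) X M := by
  have key : ∀ e j (M : ModuleCat.{0} Γ), Module.Finite Γ M →
      (∀ i, ExtVanish Γ (i + 1) T M) → n < j + 1 + e → ExtVanish Γ (j + 1) X M := by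
    intro e
    induction e with
    | zero => exact fun j M _ _ hj => hX.extVanish M hj
    | succ e ih =>
      intro j M hM hTM hj
      obtain ⟨r, N, f, p, hfp, hN, hTN, -⟩ := exists_perp_cover K hfin hTT ht hs M hM hTM
      exact ExtVanish.quot_of_shortExact hfp (ExtVanish.pi_right fun _ => hXT j)
        (ih (j + 1) N hN hTN (by omega))
  exact key n j M hM hTM (by omega)

theorem MemAdd.inl (X Y : ModuleCat.{0} Γ) : MemAdd (ModuleCat.of Γ (X × Y)) X :=
  memAdd_iff.2 ⟨1, fun _ => LinearMap.inl Γ X Y, fun _ => LinearMap.fst Γ X Y, by ext; simp⟩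

theorem MemAdd.inr (X Y : ModuleCat.{0} Γ) : MemAdd (ModuleCat.of Γ (X × Y)) Y :=
  memAdd_iff.2 ⟨1, fun _ => LinearMap.inr Γ X Y, fun _ => LinearMap.snd Γ X Y, by ext; simp⟩

theorem MemAdd.trans {X Y Z : ModuleCat.{0} Γ} (h : MemAdd X Y) (h' : MemAdd Y Z) :
    MemAdd X Z := by
  obtain ⟨n, a, b, hab⟩ := memAdd_iff.1 h
  obtain ⟨m, c, d, hcd⟩ := memAdd_iff.1 h'
  let e : Fin (m * n) ≃ Fin m × Fin n := finProdFinEquiv.symm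
  refine memAdd_iff.2 ⟨m * n, fun i => a (e i).2 ∘ₗ c (e i).1, fun i => d (e i).1 ∘ₗ b (e i).2, ?_⟩
  rw [e.sum_comp (fun q => (d q.1 ∘ₗ b q.2) ∘ₗ (a q.2 ∘ₗ c q.1)), Fintype.sum_prod_type, ← hcd]
  refine Finset.sum_congr rfl fun i _ => ?_
  ext x
  have := congrArg (d i) (LinearMap.congr_fun hab (c i x))
  simpa [LinearMap.sum_apply] using this

/-- A special tilting module is equivalent to the sum of the projective-injective part and the
last term of the coresolution of the regular module. -/
theorem memAdd_of_seqOf (K : Type) [Field K] [Algebra K Γ] [FiniteDimensional K Γ]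
    {T P t : ModuleCat.{0} Γ} {k n : ℕ} (hTfin : Module.Finite Γ T)
    (hPfin : Module.Finite Γ P) (hP : ProjInj P) (hTT : ∀ i, ExtVanish Γ (i + 1) T T)
    (hpd : PdimLE n T) (ht : MemAdd T t) (hs : SeqOf (MemAdd P) k (reg Γ) t) :
    MemAdd (ModuleCat.of Γ (P × t)) T := by
  have htfin : Module.Finite Γ t := ht.finite hTfin
  have hPproj := hP.1
  have hfin : Module.Finite Γ (ModuleCat.of Γ (P × t)) :=
    (inferInstance : Module.Finite Γ (P × t))
  have hTt : ∀ i, ExtVanish Γ (i + 1) T (P × t) := fun i =>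
    ExtVanish.prod_right (ExtVanish.of_injective hP.2 i) (ExtVanish.of_memAdd_right ht (hTT i))
  have h1 : ∀ i, ExtVanish Γ (i + 1) (P × t) (P × t) := fun i =>
    ExtVanish.prod_left (ExtVanish.of_projective i) (ExtVanish.of_memAdd_left ht (hTt i))
  have h2 : ∀ i, ExtVanish Γ (i + 1) (P × t) T := fun i =>
    ExtVanish.prod_left (ExtVanish.of_projective i) (ExtVanish.of_memAdd_left ht (hTT i))
  have hs' : SeqOf (MemAdd (ModuleCat.of Γ (P × t))) k (reg Γ) t :=
    hs.mono fun X hX => (MemAdd.inl P t).trans hX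
  obtain ⟨r, N, f, p, hfp, hN, hTN, -⟩ :=
    exists_perp_cover K hfin h1 (MemAdd.inr P t) hs' T hTfin h2
  obtain ⟨s, hs⟩ := ExtVanish.exists_lift hfp
    (extVanish_perp K hfin h1 (MemAdd.inr P t) hs' hpd hTt N hN hTN 0) LinearMap.id
  exact ⟨r, s, p, hs⟩

end Approximation

section HomFunctor

variable {Γ : Type} [Ring Γ] {T M N L : Type} [AddCommGroup T] [AddCommGroup M]
  [AddCommGroup N] [AddCommGroup L] [Module Γ T] [Module Γ M] [Module Γ N] [Module Γ L]

/-- `Hom_Γ(T, M)` as a left module over `End_Γ(T)ᵒᵖ`, by precomposition. -/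
@[reducible]
def homModule (T M : Type) [AddCommGroup T] [AddCommGroup M] [Module Γ T] [Module Γ M] :
    Module (Module.End Γ T)ᵐᵒᵖ (T →ₗ[Γ] M) where
  smul b h := h ∘ₗ b.unop
  one_smul _ := rfl
  mul_smul _ _ _ := rfl
  smul_zero _ := rfl
  smul_add _ _ _ := rfl
  add_smul b c h := LinearMap.comp_add b.unop c.unop h
  zero_smul h := LinearMap.comp_zero h

attribute [local instance] homModule

/-- Postcomposition as a map of `End_Γ(T)ᵒᵖ`-modules. -/
def homMap (T : Type) [AddCommGroup T] [Module Γ T] (f : M →ₗ[Γ] N) :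
    (T →ₗ[Γ] M) →ₗ[(Module.End Γ T)ᵐᵒᵖ] (T →ₗ[Γ] N) where
  toFun h := f ∘ₗ h
  map_add' h h' := LinearMap.comp_add h h' f
  map_smul' _ _ := rfl

@[simp]
theorem homMap_apply (f : M →ₗ[Γ] N) (h : T →ₗ[Γ] M) : homMap T f h = f ∘ₗ h := rfl

theorem homMap_comp (g : N →ₗ[Γ] L) (f : M →ₗ[Γ] N) :
    homMap T (g ∘ₗ f) = homMap T g ∘ₗ homMap T f := rfl

/-- `Hom_Γ(T, T^r)` is free of rank `r`. -/
def homPiEquiv (T : Type) [AddCommGroup T] [Module Γ T] (r : ℕ) :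
    (Fin r → (Module.End Γ T)ᵐᵒᵖ) ≃ₗ[(Module.End Γ T)ᵐᵒᵖ] (T →ₗ[Γ] (Fin r → T)) where
  toFun b := LinearMap.pi fun i => (b i).unop
  invFun h i := MulOpposite.op (LinearMap.proj i ∘ₗ h)
  map_add' _ _ := rfl
  map_smul' _ _ := rfl
  left_inv _ := rfl
  right_inv _ := rfl

theorem projective_hom_pi (T : Type) [AddCommGroup T] [Module Γ T] (r : ℕ) :
    Module.Projective (Module.End Γ T)ᵐᵒᵖ (T →ₗ[Γ] (Fin r → T)) :=
  Module.Projective.of_equiv (homPiEquiv T r)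

theorem finite_hom_pi (T : Type) [AddCommGroup T] [Module Γ T] (r : ℕ) :
    Module.Finite (Module.End Γ T)ᵐᵒᵖ (T →ₗ[Γ] (Fin r → T)) :=
  Module.Finite.equiv (homPiEquiv T r)

theorem comp_eq_sum_single {r : ℕ} (f : (Fin r → T) →ₗ[Γ] M) (h : L →ₗ[Γ] (Fin r → T)) :
    f ∘ₗ h = ∑ i, (f ∘ₗ LinearMap.single Γ (fun _ => T) i) ∘ₗ (LinearMap.proj i ∘ₗ h) := by
  ext x
  simp only [LinearMap.comp_apply, LinearMap.sum_apply, LinearMap.proj_apply,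
    LinearMap.coe_single]
  rw [← map_sum, Finset.univ_sum_single]

/-- Every `End_Γ(T)ᵒᵖ`-linear map out of `Hom_Γ(T, T^r)` is induced by a map of modules. -/
theorem exists_homMap_eq {r : ℕ}
    (φ : (T →ₗ[Γ] (Fin r → T)) →ₗ[(Module.End Γ T)ᵐᵒᵖ] (T →ₗ[Γ] M)) :
    ∃ f : (Fin r → T) →ₗ[Γ] M, homMap T f = φ := by
  refine ⟨∑ i, φ (LinearMap.single Γ (fun _ => T) i) ∘ₗ LinearMap.proj i, ?_⟩
  ext1 h
  have hh := comp_eq_sum_single (LinearMap.id : (Fin r → T) →ₗ[Γ] _) h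
  rw [LinearMap.id_comp] at hh
  conv_rhs => rw [hh]
  rw [map_sum]
  ext x
  simp only [homMap_apply, LinearMap.comp_apply, LinearMap.sum_apply]
  refine Finset.sum_congr rfl fun i _ => ?_
  exact (LinearMap.congr_fun (φ.map_smul (MulOpposite.op (LinearMap.proj i ∘ₗ h))
    (LinearMap.single Γ (fun _ => T) i)) x).symm

theorem ShortExactSeq.homMap {f : M →ₗ[Γ] N} {p : N →ₗ[Γ] L} (h : ShortExactSeq f p)
    (hp : ∀ u : T →ₗ[Γ] L, ∃ v : T →ₗ[Γ] N, p ∘ₗ v = u) :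
    ShortExactSeq (homMap T f) (homMap T p) where
  inj u v huv := by
    ext x
    exact h.inj (LinearMap.congr_fun huv x)
  exact := by
    intro u
    constructor
    · intro hu
      have hu' : ∀ x, ∃ y, f y = u x := fun x => (h.exact (u x)).1 (LinearMap.congr_fun hu x)
      choose v hv using hu'
      refine ⟨⟨⟨v, fun x y => h.inj ?_⟩, fun c x => h.inj ?_⟩, ?_⟩
      · rw [map_add, hv, hv, hv, map_add]
      · rw [map_smul, hv, hv, map_smul, RingHom.id_apply]
      · ext x
        exact hv x
    · rintro ⟨v, rfl⟩
      ext x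
      exact h.exact.apply_apply_eq_zero (v x)
  surj := hp

/-- A comparison of the projective dimension of `Hom_Γ(T, M)` with that of `M`. -/
theorem extVanish_of_homModule (K : Type) [Field K] [Algebra K Γ] [FiniteDimensional K Γ]
    {T t : ModuleCat.{0} Γ} {k m : ℕ} (hfin : Module.Finite Γ T)
    (hTT : ∀ i, ExtVanish Γ (i + 1) T T) (ht : MemAdd T t)
    (hs : SeqOf (MemAdd T) k (reg Γ) t) {L : ModuleCat.{0} Γ}
    (hTL : ∀ j, m < j → ExtVanish Γ j T L) (g : ℕ) (M : ModuleCat.{0} Γ)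
    (hM : Module.Finite Γ M) (hTM : ∀ i, ExtVanish Γ (i + 1) T M)
    (hB : ∀ X : ModuleCat.{0} (Module.End Γ T)ᵐᵒᵖ, ExtVanish (Module.End Γ T)ᵐᵒᵖ (g + 1)
      (T →ₗ[Γ] M) X) (j : ℕ) (hj : g + m < j) : ExtVanish Γ j M L := by
  induction g generalizing M j with
  | zero =>
    obtain ⟨r, N, f, p, hfp, hN, hTN, hp⟩ := exists_perp_cover K hfin hTT ht hs M hM hTM
    obtain ⟨s, N', f', q, hfq, -, -, -⟩ := exists_perp_cover K hfin hTT ht hs N hN hTN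
    obtain ⟨ρ, hρ⟩ := ExtVanish.exists_extend (hfp.homMap hp)
      (hB (ModuleCat.of _ (T →ₗ[Γ] N))) LinearMap.id
    obtain ⟨u, rfl⟩ := exists_homMap_eq ρ
    have huf : u ∘ₗ f = LinearMap.id := by
      rw [← LinearMap.cancel_right hfq.surj]
      ext i x : 2
      exact LinearMap.congr_fun (LinearMap.congr_fun hρ
        (q ∘ₗ LinearMap.single Γ (fun _ => (T : Type)) i)) x
    have hsplit := (hfp.exact.split_tfae hfp.inj hfp.surj).out 1 0
    obtain ⟨v, hv⟩ := hsplit.1 ⟨u, huf⟩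
    refine ExtVanish.of_memAdd_left (P := T) (Q := M) ⟨r, v, p, hv⟩ (hTL j (by omega))
  | succ g ih =>
    obtain ⟨r, N, f, p, hfp, hN, hTN, hp⟩ := exists_perp_cover K hfin hTT ht hs M hM hTM
    have := projective_hom_pi (Γ := Γ) T r
    obtain ⟨j, rfl⟩ : ∃ i, j = i + 1 := ⟨j - 1, by omega⟩
    refine ExtVanish.right_of_shortExact hfp (ih N hN hTN (fun X => ?_) j (by omega))
      (ExtVanish.pi_left fun _ => hTL _ (by omega))
    exact ExtVanish.left_of_shortExact (hfp.homMap hp) (ExtVanish.of_projective g) (hB X)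

end HomFunctor

section Cokernels

variable {R : Type} [Ring R]

theorem ShortExactSeq.coker {A B C : Type} [AddCommGroup A] [AddCommGroup B] [AddCommGroup C]
    [Module R A] [Module R B] [Module R C] {f : A →ₗ[R] B} {g : B →ₗ[R] C}
    (h : Function.Exact f g) :
    ShortExactSeq
      ((LinearMap.range f).liftQ g (LinearMap.range_le_ker_iff.2 h.linearMap_comp_eq_zero))
      (LinearMap.range g).mkQ where
  inj := by
    rw [← LinearMap.ker_eq_bot]
    exact Submodule.ker_liftQ_eq_bot _ _ _ (LinearMap.exact_iff.1 h).le
  exact := by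
    rw [LinearMap.exact_iff, Submodule.ker_mkQ, Submodule.range_liftQ]
  surj := Submodule.mkQ_surjective _

/-- Maps killing the submodule factor through the quotient of a short exact sequence. -/
theorem ShortExactSeq.exists_desc {A B C N : Type} [AddCommGroup A] [AddCommGroup B]
    [AddCommGroup C] [AddCommGroup N] [Module R A] [Module R B] [Module R C] [Module R N]
    {f : A →ₗ[R] B} {g : B →ₗ[R] C} (h : ShortExactSeq f g) (u : B →ₗ[R] N) (hu : u ∘ₗ f = 0) :
    ∃ v : C →ₗ[R] N, v ∘ₗ g = u := by
  refine ⟨(LinearMap.range f).liftQ u (LinearMap.range_le_ker_iff.2 hu) ∘ₗ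
    (h.exact.linearEquivOfSurjective h.surj).symm.toLinearMap, ?_⟩
  ext x
  simp [Function.Exact.linearEquivOfSurjective_symm_apply]

variable {C : ℕ → Type} [∀ i, AddCommGroup (C i)] [∀ i, Module R (C i)]
  (d : ∀ i, C (i + 1) →ₗ[R] C i)

theorem isSummand_coker {A B : Type} [AddCommGroup A] [AddCommGroup B] [Module R A]
    [Module R B] {f : A →ₗ[R] B} {s : B →ₗ[R] A} (hs : f ∘ₗ s ∘ₗ f = f) :
    IsSummand (ModuleCat.of R (B ⧸ LinearMap.range f)) (ModuleCat.of R B) := by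
  refine ⟨(LinearMap.range f).liftQ (LinearMap.id - f ∘ₗ s) ?_, (LinearMap.range f).mkQ, ?_⟩
  · rw [LinearMap.range_le_ker_iff, LinearMap.sub_comp, LinearMap.comp_assoc, hs,
      LinearMap.id_comp, sub_self]
  · refine Submodule.linearMap_qext _ ?_
    ext x
    simp [LinearMap.sub_apply]

theorem extVanish_coker_zero [∀ i, Module.Projective R (C i)]
    (hd : ∀ i, Function.Exact (d (i + 1)) (d i)) (N : Type) [AddCommGroup N] [Module R N]
    (i a : ℕ) (h : ExtVanish R (a + 1) (C i ⧸ LinearMap.range (d i)) N) :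
    ExtVanish R (a + i + 1) (C 0 ⧸ LinearMap.range (d 0)) N := by
  induction i generalizing a with
  | zero => exact h
  | succ i ih =>
    rw [show a + (i + 1) + 1 = a + 1 + i + 1 by omega]
    exact ih (a + 1) (ExtVanish.right_of_shortExact (ShortExactSeq.coker (hd i)) h
      (ExtVanish.of_projective (a + 1)))

/-- A projective resolution which splits at step `j` bounds the projective dimension. -/
theorem extVanish_of_split [∀ i, Module.Projective R (C i)]
    (hd : ∀ i, Function.Exact (d (i + 1)) (d i)) {X : Type} [AddCommGroup X] [Module R X]
    {p : C 0 →ₗ[R] X} (hp : Function.Surjective p) (hdp : Function.Exact (d 0) p)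
    {j : ℕ} {s : C j →ₗ[R] C (j + 1)} (hs : d j ∘ₗ s ∘ₗ d j = d j)
    (N : Type) [AddCommGroup N] [Module R N] : ExtVanish R (j + 1) X N := by
  have hproj : Module.Projective R (C j ⧸ LinearMap.range (d j)) :=
    (isSummand_coker hs).projective (inferInstance : Module.Projective R (C j))
  have h := extVanish_coker_zero d hd N j 0 (ExtVanish.of_projective 0)
  rw [Nat.zero_add] at h
  exact ExtVanish.congr_left ((Submodule.quotEquivOfEq _ _ (LinearMap.exact_iff.1 hdp).symm).trans
    (p.quotKerEquivOfSurjective hp)) h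

end Cokernels

section TiltedResolution

variable {Γ : Type} [Ring Γ] {T : Type} [AddCommGroup T] [Module Γ T]

attribute [local instance] homModule

theorem exists_homMap_exact [IsNoetherianRing (Module.End Γ T)ᵐᵒᵖ] {b : ℕ} {Y : Type}
    [AddCommGroup Y] [Module (Module.End Γ T)ᵐᵒᵖ Y]
    (φ : (T →ₗ[Γ] (Fin b → T)) →ₗ[(Module.End Γ T)ᵐᵒᵖ] Y) :
    ∃ (c : ℕ) (δ : (Fin c → T) →ₗ[Γ] (Fin b → T)), Function.Exact (homMap T δ) φ := by
  have := finite_hom_pi (Γ := Γ) T b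
  obtain ⟨c, q, hq⟩ := exists_free_cover (R := (Module.End Γ T)ᵐᵒᵖ) (LinearMap.ker φ)
  obtain ⟨δ, hδ⟩ := exists_homMap_eq
    ((LinearMap.ker φ).subtype ∘ₗ q ∘ₗ (homPiEquiv T c).symm.toLinearMap)
  refine ⟨c, δ, ?_⟩
  rw [hδ, LinearMap.exact_iff, LinearMap.range_comp, LinearMap.range_comp,
    LinearEquiv.range, Submodule.map_top, LinearMap.range_eq_top.2 hq, Submodule.map_top,
    Submodule.range_subtype]

/-- A free resolution of a module over `End_Γ(T)ᵒᵖ`, described by maps between powers of `T`. -/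
theorem exists_tilted_resolution [IsNoetherianRing (Module.End Γ T)ᵐᵒᵖ]
    (X : Type) [AddCommGroup X] [Module (Module.End Γ T)ᵐᵒᵖ X]
    [Module.Finite (Module.End Γ T)ᵐᵒᵖ X] :
    ∃ (r : ℕ → ℕ) (δ : ∀ i, (Fin (r (i + 1)) → T) →ₗ[Γ] (Fin (r i) → T)),
      (∀ i, Function.Exact (homMap T (δ (i + 1))) (homMap T (δ i))) ∧
      ∀ j, (∃ s, δ j ∘ₗ s ∘ₗ δ j = δ j) →
        ∀ N : ModuleCat.{0} (Module.End Γ T)ᵐᵒᵖ, ExtVanish (Module.End Γ T)ᵐᵒᵖ (j + 1) X N := by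
  obtain ⟨r₀, q, hq⟩ := exists_free_cover (R := (Module.End Γ T)ᵐᵒᵖ) X
  let p : (T →ₗ[Γ] (Fin r₀ → T)) →ₗ[(Module.End Γ T)ᵐᵒᵖ] X :=
    q ∘ₗ (homPiEquiv T r₀).symm.toLinearMap
  have hp : Function.Surjective p := hq.comp (homPiEquiv T r₀).symm.surjective
  obtain ⟨r₁, δ₀, hδ₀⟩ := exists_homMap_exact p
  choose c δ' hδ' using fun (a b : ℕ) (δ : (Fin b → T) →ₗ[Γ] (Fin a → T)) =>
    exists_homMap_exact (homMap T δ)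
  let st : ℕ → Σ a b : ℕ, ((Fin b → T) →ₗ[Γ] (Fin a → T)) := fun i =>
    Nat.rec ⟨r₀, r₁, δ₀⟩ (fun _ s => ⟨s.2.1, c s.1 s.2.1 s.2.2, δ' s.1 s.2.1 s.2.2⟩) i
  let r : ℕ → ℕ := fun i => (st i).1
  let δ : ∀ i, (Fin (r (i + 1)) → T) →ₗ[Γ] (Fin (r i) → T) := fun i => (st i).2.2
  have hex : ∀ i, Function.Exact (homMap T (δ (i + 1))) (homMap T (δ i)) := fun i =>
    hδ' (st i).1 (st i).2.1 (st i).2.2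
  refine ⟨r, δ, hex, ?_⟩
  rintro j ⟨s, hs⟩ N
  have hproj := fun i => projective_hom_pi (Γ := Γ) T (r i)
  refine extVanish_of_split (C := fun i => T →ₗ[Γ] (Fin (r i) → T))
    (fun i => homMap T (δ i)) hex (p := p) hp hδ₀ (j := j) (s := homMap T s) ?_ N
  rw [← homMap_comp, ← homMap_comp, hs]

end TiltedResolution

section UpperBound

variable {Γ : Type} [Ring Γ]

theorem finite_end (K : Type) [Field K] [Algebra K Γ] [FiniteDimensional K Γ]
    (T : Type) [AddCommGroup T] [Module Γ T] [Module.Finite Γ T] [Module K T]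
    [IsScalarTower K Γ T] [SMulCommClass Γ K T] : Module.Finite K (Module.End Γ T) := by
  have : Module.Finite K T := Module.Finite.trans Γ T
  exact Module.Finite.of_injective (LinearMap.restrictScalarsₗ K Γ T T K)
    (LinearMap.restrictScalars_injective K)

theorem isNoetherianRing_endOp (K : Type) [Field K] [Algebra K Γ] [FiniteDimensional K Γ]
    (T : Type) [AddCommGroup T] [Module Γ T] [Module.Finite Γ T] :
    IsNoetherianRing (Module.End Γ T)ᵐᵒᵖ := by
  let : Module K T := Module.compHom T (algebraMap K Γ)
  have : IsScalarTower K Γ T := isScalarTower_compHom K Γ T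
  have : SMulCommClass Γ K T := IsScalarTower.to_smulCommClass'
  have : Module.Finite K (Module.End Γ T) := finite_end K T
  have : Module.Finite K (Module.End Γ T)ᵐᵒᵖ :=
    Module.Finite.equiv (MulOpposite.opLinearEquiv K)
  exact IsNoetherianRing.of_finite K _

attribute [local instance] homModule

variable {T t : ModuleCat.{0} Γ} {r : ℕ → ℕ}
  {δ : ∀ i, (Fin (r (i + 1)) → T) →ₗ[Γ] (Fin (r i) → T)}

theorem exists_lift_of_memAdd {a b c : ℕ} {u : (Fin a → T) →ₗ[Γ] (Fin b → T)}
    {v : (Fin b → T) →ₗ[Γ] (Fin c → T)} (h : Function.Exact (homMap T u) (homMap T v))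
    {A : ModuleCat.{0} Γ} (hA : MemAdd T A) (f : A →ₗ[Γ] (Fin b → T)) (hf : v ∘ₗ f = 0) :
    ∃ g : A →ₗ[Γ] (Fin a → T), u ∘ₗ g = f := by
  obtain ⟨n, x, y, hxy⟩ := memAdd_iff.1 hA
  have hlift : ∀ i, ∃ g : T →ₗ[Γ] (Fin a → T), u ∘ₗ g = f ∘ₗ y i := fun i =>
    (h (f ∘ₗ y i)).1 (by rw [homMap_apply, ← LinearMap.comp_assoc, hf, LinearMap.zero_comp])
  choose g hg using hlift
  refine ⟨∑ i, g i ∘ₗ x i, ?_⟩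
  ext1 m
  have h1 := congrArg f (LinearMap.congr_fun hxy m)
  rw [LinearMap.id_apply, LinearMap.sum_apply, map_sum] at h1
  rw [← h1, LinearMap.comp_apply, LinearMap.sum_apply, map_sum]
  exact Finset.sum_congr rfl fun i _ => LinearMap.congr_fun (hg i) (x i m)

theorem homMap_exact_comp_eq_zero {a b c : ℕ} {u : (Fin a → T) →ₗ[Γ] (Fin b → T)}
    {v : (Fin b → T) →ₗ[Γ] (Fin c → T)} (h : Function.Exact (homMap T u) (homMap T v)) :
    v ∘ₗ u = 0 := by
  ext i x : 2
  exact LinearMap.congr_fun (h.apply_apply_eq_zero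
    (LinearMap.single Γ (fun _ => (T : Type)) i)) x

theorem exists_lift_of_seqOf (hTT : ∀ i, ExtVanish Γ (i + 1) T T) (ht : MemAdd T t)
    (hδ : ∀ i, Function.Exact (homMap T (δ (i + 1))) (homMap T (δ i))) {e : ℕ}
    {A : ModuleCat.{0} Γ} (hs : SeqOf (MemAdd T) e A t) {j : ℕ} (hj : e ≤ j)
    (h : A →ₗ[Γ] (Fin (r (j + 1)) → T)) (hh : δ j ∘ₗ h = 0) :
    ∃ h' : A →ₗ[Γ] (Fin (r (j + 2)) → T), δ (j + 1) ∘ₗ h' = h := by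
  induction e generalizing A j with
  | zero =>
    obtain ⟨e⟩ := hs
    exact exists_lift_of_memAdd (hδ j)
      (ht.of_summand ⟨e.toLinearMap, e.symm.toLinearMap, by ext; simp⟩) h hh
  | succ e ih =>
    obtain ⟨j, rfl⟩ : ∃ i, j = i + 1 := ⟨j - 1, by omega⟩
    obtain ⟨t', A', f, g, ht', hfg, hs'⟩ := hs
    obtain ⟨H, rfl⟩ := ExtVanish.exists_extend hfg (N := Fin (r (j + 1 + 1)) → T)
      (ExtVanish.pi_right fun _ => hs'.extVanish_first
        (fun t ht i => ExtVanish.of_memAdd_left ht (hTT i))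
        (fun i => ExtVanish.of_memAdd_left ht (hTT i)) 0) h
    obtain ⟨u, hu⟩ := hfg.exists_desc (δ (j + 1) ∘ₗ H) hh
    have hu0 : δ j ∘ₗ u = 0 := by
      rw [← LinearMap.cancel_right hfg.surj, LinearMap.comp_assoc, hu, ← LinearMap.comp_assoc,
        homMap_exact_comp_eq_zero (hδ j), LinearMap.zero_comp, LinearMap.zero_comp]
    obtain ⟨v, hv⟩ := ih hs' (by omega) u hu0
    obtain ⟨w, hw⟩ := exists_lift_of_memAdd (hδ (j + 1)) ht' (H - v ∘ₗ g) (by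
      rw [LinearMap.comp_sub, ← LinearMap.comp_assoc, hv, hu, sub_self])
    refine ⟨w ∘ₗ f, ?_⟩
    rw [← LinearMap.comp_assoc, hw, LinearMap.sub_comp, LinearMap.comp_assoc,
      hfg.exact.linearMap_comp_eq_zero, LinearMap.comp_zero, sub_zero]

theorem exact_of_seqOf (hTT : ∀ i, ExtVanish Γ (i + 1) T T) (ht : MemAdd T t)
    (hδ : ∀ i, Function.Exact (homMap T (δ (i + 1))) (homMap T (δ i))) {k : ℕ}
    (hs : SeqOf (MemAdd T) k (reg Γ) t) {j : ℕ} (hj : k ≤ j) :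
    Function.Exact (δ (j + 1)) (δ j) := by
  intro x
  constructor
  · intro hx
    let u : reg Γ →ₗ[Γ] (Fin (r (j + 1)) → T) := LinearMap.toSpanSingleton Γ _ x
    have hu : u (1 : Γ) = x := LinearMap.toSpanSingleton_apply_one Γ _ x
    obtain ⟨h', hh'⟩ := exists_lift_of_seqOf hTT ht hδ hs hj u (by
      refine LinearMap.ext_ring (R := Γ) ?_
      exact (congrArg (δ j) hu).trans hx)
    exact ⟨h' (1 : Γ), (LinearMap.congr_fun hh' (1 : Γ)).trans hu⟩
  · rintro ⟨y, rfl⟩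
    exact LinearMap.congr_fun (homMap_exact_comp_eq_zero (hδ j)) y

/-- The global dimension of the shifted algebra is at most that of `Γ`. -/
theorem gldimLE_endOp (K : Type) [Field K] [Algebra K Γ] [FiniteDimensional K Γ]
    {P T t : ModuleCat.{0} Γ} {k n : ℕ} (hTfin : Module.Finite Γ T)
    (hPfin : Module.Finite Γ P) (hP : ProjInj P) (hTT : ∀ i, ExtVanish Γ (i + 1) T T)
    (ht : MemAdd T t) (hs : SeqOf (fun X => MemAdd P X ∧ MemAdd T X) k (reg Γ) t)
    (hgl : GldimLE Γ n) (hkn : k ≤ n) : GldimLE (Module.End Γ T)ᵐᵒᵖ n := by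
  have hsP : SeqOf (MemAdd P) k (reg Γ) t := hs.mono fun X hX => hX.1
  have hsT : SeqOf (MemAdd T) k (reg Γ) t := hs.mono fun X hX => hX.2
  have hnoeth := isNoetherianRing_endOp K (Γ := Γ) T
  have hMT : ∀ (M : ModuleCat.{0} Γ), Module.Finite Γ M → ∀ j, n < j + 1 + k →
      ExtVanish Γ (j + 1) M T := by
    intro M hM j hj
    refine ExtVanish.of_memAdd_right (memAdd_of_seqOf K hTfin hPfin hP hTT (hgl T hTfin) ht hsP)
      (ExtVanish.prod_right (ExtVanish.of_injective hP.2 j) ?_)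
    exact hsP.extVanish_right
      (fun X hX i => ExtVanish.of_injective (MemAdd.projInj hP hX).2 i)
      ((hgl M hM).extVanish _ (by omega))
  intro X hX
  refine pdimLE_of_extVanish hX fun N _ => ?_
  obtain ⟨r, δ, hδ, hsplit⟩ := exists_tilted_resolution (Γ := Γ) (T := T) X
  refine hsplit n ?_ N
  have hex : ∀ j, k ≤ j → Function.Exact (δ (j + 1)) (δ j) := fun j hj =>
    exact_of_seqOf hTT ht hδ hsT hj
  let W : ℕ → ModuleCat.{0} Γ := fun i =>
    ModuleCat.of Γ ((Fin (r i) → T) ⧸ LinearMap.range (δ i))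
  have hWfin : ∀ i, Module.Finite Γ (W i) := fun i =>
    (inferInstance : Module.Finite Γ ((Fin (r i) → T) ⧸ LinearMap.range (δ i)))
  have hWT : ∀ e a, n < a + 1 + k + e → ExtVanish Γ (a + 1) (W (k + e)) T := by
    intro e
    induction e with
    | zero => exact fun a ha => hMT _ (hWfin _) a (by omega)
    | succ e ih =>
      intro a ha
      exact ExtVanish.left_of_shortExact (ShortExactSeq.coker (hex (k + e) (by omega)))
        (ExtVanish.pi_left fun _ => hTT a) (ih (a + 1) (by omega))
  have hWW : ∀ j, n ≤ j → ∀ e a l, k ≤ l → n < a + 1 + e → ExtVanish Γ (a + 1) (W j) (W l) := by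
    intro j hj e
    induction e with
    | zero => exact fun a l _ ha => (hgl _ (hWfin j)).extVanish _ (by omega)
    | succ e ih =>
      intro a l hl ha
      refine ExtVanish.quot_of_shortExact (ShortExactSeq.coker (hex l hl))
        (ExtVanish.pi_right fun _ => ?_) (ih (a + 1) (l + 1) (by omega) (by omega))
      obtain ⟨i, rfl⟩ : ∃ i, j = k + i := ⟨j - k, by omega⟩
      exact hWT i a (by omega)
  have h1 := ShortExactSeq.coker (hex n hkn)
  have h2 := ShortExactSeq.coker (hex (n + 1) (by omega))
  obtain ⟨x, hx⟩ := ExtVanish.exists_extend h1 (hWW n le_rfl n 0 (n + 1) (by omega) (by omega))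
    LinearMap.id
  obtain ⟨y, hy⟩ := ExtVanish.exists_lift h2
    (hWW (n + 1) (by omega) n 0 (n + 2) (by omega) (by omega)) LinearMap.id
  refine ⟨y ∘ₗ x, ?_⟩
  refine LinearMap.ext fun z => ?_
  have hx' := LinearMap.congr_fun hx (Submodule.Quotient.mk z)
  have hdy : ∀ w : W (n + 1), δ n (y w) = (LinearMap.range (δ (n + 1))).liftQ (δ n)
      (LinearMap.range_le_ker_iff.2 (hex n hkn).linearMap_comp_eq_zero) w := by
    intro w
    conv_rhs => rw [← LinearMap.id_apply (R := Γ) w, ← hy]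
    rfl
  simp only [LinearMap.comp_apply] at hx' ⊢
  rw [hdy]
  have : x (δ n z) = Submodule.Quotient.mk z := hx'
  rw [this]
  rfl

end UpperBound

section Duality

/-- A `K`-linear anti-isomorphism between `K`-algebras. -/
structure AntiIso (K A A' : Type) [Field K] [Ring A] [Ring A'] [Algebra K A] [Algebra K A'] where
  /-- the underlying map -/
  toFun : A → A'
  /-- the inverse map -/
  invFun : A' → A
  left_inv : ∀ a, invFun (toFun a) = a
  right_inv : ∀ a, toFun (invFun a) = a
  map_add : ∀ a b, toFun (a + b) = toFun a + toFun b
  map_mul : ∀ a b, toFun (a * b) = toFun b * toFun a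
  map_algebraMap : ∀ c, toFun (algebraMap K A c) = algebraMap K A' c

variable {K A A' : Type} [Field K] [Ring A] [Ring A'] [Algebra K A] [Algebra K A']

/-- The inverse of an anti-isomorphism. -/
def AntiIso.symm (σ : AntiIso K A A') : AntiIso K A' A where
  toFun := σ.invFun
  invFun := σ.toFun
  left_inv := σ.right_inv
  right_inv := σ.left_inv
  map_add a b := by
    rw [← σ.left_inv (σ.invFun a + σ.invFun b), σ.map_add, σ.right_inv, σ.right_inv]
  map_mul a b := by
    rw [← σ.left_inv (σ.invFun b * σ.invFun a), σ.map_mul, σ.right_inv, σ.right_inv]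
  map_algebraMap c := by rw [← σ.map_algebraMap, σ.left_inv]

/-- The `K`-linear dual of an `A`-module, seen as a module over the algebra `A'` which is
anti-isomorphic to `A`. -/
def KDual (_σ : AntiIso K A A') (M : Type) [AddCommGroup M] [Module A M] : Type :=
  letI : Module K M := Module.compHom M (algebraMap K A)
  M →ₗ[K] K

variable (σ : AntiIso K A A') {M N L X Y : Type} [AddCommGroup M] [AddCommGroup N]
  [AddCommGroup L] [AddCommGroup X] [AddCommGroup Y] [Module A M] [Module A N] [Module A L]
  [Module A' X] [Module A' Y]

namespace KDual

instance : AddCommGroup (KDual σ M) :=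
  letI : Module K M := Module.compHom M (algebraMap K A)
  (LinearMap.addCommGroup : AddCommGroup (M →ₗ[K] K))

instance : FunLike (KDual σ M) M K :=
  letI : Module K M := Module.compHom M (algebraMap K A)
  (LinearMap.instFunLike : FunLike (M →ₗ[K] K) M K)

instance : AddMonoidHomClass (KDual σ M) M K :=
  letI : Module K M := Module.compHom M (algebraMap K A)
  (inferInstance : AddMonoidHomClass (M →ₗ[K] K) M K)

variable {σ}

theorem map_algebraMap_smul (φ : KDual σ M) (c : K) (m : M) :
    φ (algebraMap K A c • m) = c * φ m :=
  letI : Module K M := Module.compHom M (algebraMap K A)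
  LinearMap.map_smul (show M →ₗ[K] K from φ) c m

@[ext]
theorem ext {φ ψ : KDual σ M} (h : ∀ m, φ m = ψ m) : φ = ψ :=
  DFunLike.ext _ _ h

variable (σ) in
/-- Construct an element of the dual. -/
def mk (f : M →+ K) (h : ∀ c m, f (algebraMap K A c • m) = c * f m) : KDual σ M :=
  letI : Module K M := Module.compHom M (algebraMap K A)
  ({ f with map_smul' := h } : M →ₗ[K] K)

@[simp]
theorem add_apply (φ ψ : KDual σ M) (m : M) : (φ + ψ) m = φ m + ψ m := rfl

@[simp]
theorem zero_apply (m : M) : (0 : KDual σ M) m = 0 := rfl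

instance : SMul A' (KDual σ M) where
  smul a φ := mk σ ((φ : M →+ K).comp (DistribSMul.toAddMonoidHom M (σ.invFun a))) fun c m => by
    have : σ.invFun a • algebraMap K A c • m = algebraMap K A c • σ.invFun a • m := by
      rw [← mul_smul, ← mul_smul, Algebra.commutes]
    exact (congrArg φ this).trans (map_algebraMap_smul φ c _)

@[simp]
theorem smul_apply (a : A') (φ : KDual σ M) (m : M) : (a • φ) m = φ (σ.invFun a • m) := rfl

instance : Module A' (KDual σ M) where
  one_smul φ := by
    ext m
    have : σ.invFun 1 = 1 := by
      have h := σ.symm.map_algebraMap 1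
      rwa [map_one, map_one] at h
    rw [smul_apply, this, one_smul]
  mul_smul a b φ := by
    ext m
    have : σ.invFun (a * b) = σ.invFun b * σ.invFun a := σ.symm.map_mul a b
    rw [smul_apply, smul_apply, smul_apply, this, mul_smul]
  smul_zero a := by ext m; simp
  smul_add a φ ψ := by ext m; simp
  add_smul a b φ := by
    ext m
    have : σ.invFun (a + b) = σ.invFun a + σ.invFun b := σ.symm.map_add a b
    rw [add_apply, smul_apply, smul_apply, smul_apply, this, add_smul, map_add]
  zero_smul φ := by
    ext m
    have : σ.invFun 0 = 0 := by
      have h := σ.symm.map_algebraMap 0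
      rwa [map_zero, map_zero] at h
    rw [smul_apply, this, zero_smul, map_zero, zero_apply]

theorem algebraMap_smul_apply (c : K) (φ : KDual σ M) (m : M) :
    (algebraMap K A' c • φ) m = c * φ m := by
  have : σ.invFun (algebraMap K A' c) = algebraMap K A c := σ.symm.map_algebraMap c
  rw [smul_apply, this, map_algebraMap_smul]

variable (σ) in
/-- The dual of a map. -/
def map (f : M →ₗ[A] N) : KDual σ N →ₗ[A'] KDual σ M where
  toFun φ := mk σ ((φ : N →+ K).comp f.toAddMonoidHom) fun c m =>
    (congrArg φ (f.map_smul _ m)).trans (map_algebraMap_smul φ c _)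
  map_add' _ _ := rfl
  map_smul' a φ := by
    ext m
    exact (congrArg φ (f.map_smul _ m)).symm

theorem map_id : map σ (LinearMap.id : M →ₗ[A] M) = LinearMap.id := rfl

theorem map_comp (g : N →ₗ[A] L) (f : M →ₗ[A] N) : map σ (g ∘ₗ f) = map σ f ∘ₗ map σ g := rfl

theorem map_add (f g : M →ₗ[A] N) : map σ (f + g) = map σ f + map σ g := by
  ext φ m
  exact _root_.map_add φ _ _

/-- The adjunction isomorphism of the duality. -/
def flip (g : X →ₗ[A'] KDual σ M) : M →ₗ[A] KDual σ.symm X where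
  toFun m := mk σ.symm
    { toFun := fun x => g x m
      map_zero' := by simp
      map_add' := fun x y => by simp } fun c x => by
        have := algebraMap_smul_apply c (g x) m
        rwa [← g.map_smul] at this
  map_add' m m' := by
    ext x
    exact _root_.map_add (g x) m m'
  map_smul' a m := by
    ext x
    change g x (a • m) = g (σ.toFun a • x) m
    rw [g.map_smul, smul_apply, σ.left_inv]

variable (σ M) in
/-- The evaluation map into the double dual. -/
def eval : M →ₗ[A] KDual σ.symm (KDual σ M) := flip LinearMap.id

theorem eq_zero_of_forall (m : M) (h : ∀ φ : KDual σ M, φ m = 0) : m = 0 := by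
  let : Module K M := Module.compHom M (algebraMap K A)
  exact (Module.forall_dual_apply_eq_zero_iff K m).1 h

theorem eval_injective : Function.Injective (eval σ M) := by
  rw [injective_iff_map_eq_zero]
  exact fun m hm => eq_zero_of_forall (σ := σ) m fun φ => DFunLike.congr_fun hm φ

theorem eval_bijective [FiniteDimensional K A] [Module.Finite A M] :
    Function.Bijective (eval σ M) := by
  refine ⟨eval_injective, fun ψ => ?_⟩
  let : Module K M := Module.compHom M (algebraMap K A)
  have : IsScalarTower K A M := isScalarTower_compHom K A M
  have : Module.Finite K M := Module.Finite.trans A M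
  let ψ' : Module.Dual K (Module.Dual K M) :=
    { toFun := fun φ => ψ (show KDual σ M from φ)
      map_add' := fun φ φ' => _root_.map_add ψ (show KDual σ M from φ) (show KDual σ M from φ')
      map_smul' := fun c φ => by
        rw [RingHom.id_apply, smul_eq_mul, ← map_algebraMap_smul]
        refine congrArg ψ ?_
        ext m
        rw [algebraMap_smul_apply]
        rfl }
  obtain ⟨m, hm⟩ := (Module.evalEquiv K M).surjective ψ'
  exact ⟨m, KDual.ext fun φ => LinearMap.congr_fun hm φ⟩

variable (σ) in
/-- A finitely generated module is isomorphic to its double dual. -/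
noncomputable def evalEquiv (M : Type) [AddCommGroup M] [Module A M] [FiniteDimensional K A]
    [Module.Finite A M] : M ≃ₗ[A] KDual σ.symm (KDual σ M) :=
  LinearEquiv.ofBijective (eval σ M) eval_bijective

variable (σ) in
/-- A finitely generated module is isomorphic to its double dual, starting on the other side. -/
noncomputable def evalEquivSymm (X : Type) [AddCommGroup X] [Module A' X] [FiniteDimensional K A']
    [Module.Finite A' X] : X ≃ₗ[A'] KDual σ (KDual σ.symm X) :=
  evalEquiv σ.symm X

variable (σ) in
theorem finite (M : Type) [AddCommGroup M] [Module A M] [FiniteDimensional K A]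
    [Module.Finite A M] : Module.Finite A' (KDual σ M) := by
  let : Module K M := Module.compHom M (algebraMap K A)
  have : IsScalarTower K A M := isScalarTower_compHom K A M
  have : Module.Finite K M := Module.Finite.trans A M
  let : Module K (KDual σ M) := Module.compHom (KDual σ M) (algebraMap K A')
  have : IsScalarTower K A' (KDual σ M) := isScalarTower_compHom K A' (KDual σ M)
  let e : Module.Dual K M ≃ₗ[K] KDual σ M :=
    { toFun := fun φ => φ
      invFun := fun φ => φ
      left_inv := fun _ => rfl
      right_inv := fun _ => rfl
      map_add' := fun _ _ => rfl
      map_smul' := fun c φ => KDual.ext fun m => (algebraMap_smul_apply (σ := σ) c φ m).symm }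
  have : Module.Finite K (KDual σ M) := Module.Finite.equiv e
  exact Module.Finite.of_restrictScalars_finite K A' _

theorem exists_map_eq [FiniteDimensional K A] [Module.Finite A N]
    (g : KDual σ N →ₗ[A'] KDual σ M) : ∃ f : M →ₗ[A] N, map σ f = g := by
  refine ⟨(evalEquiv σ N).symm.toLinearMap ∘ₗ flip g, ?_⟩
  ext φ m
  have := (evalEquiv σ N).apply_symm_apply (flip g m)
  exact DFunLike.congr_fun this φ

theorem map_injective : Function.Injective (map σ : (M →ₗ[A] N) → _) := by
  intro f g h
  ext m
  rw [← sub_eq_zero]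
  refine eq_zero_of_forall (σ := σ) _ fun φ => ?_
  rw [map_sub, sub_eq_zero]
  exact DFunLike.congr_fun (LinearMap.congr_fun h φ) m

variable (σ) in
theorem shortExactSeq {f : M →ₗ[A] N} {g : N →ₗ[A] L} (h : ShortExactSeq f g) :
    ShortExactSeq (map σ g) (map σ f) := by
  let : Module K M := Module.compHom M (algebraMap K A)
  let : Module K N := Module.compHom N (algebraMap K A)
  let : Module K L := Module.compHom L (algebraMap K A)
  have : IsScalarTower K A M := isScalarTower_compHom K A M
  have : IsScalarTower K A N := isScalarTower_compHom K A N
  have : IsScalarTower K A L := isScalarTower_compHom K A L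
  have h' : ShortExactSeq (f.restrictScalars K) (g.restrictScalars K) := ⟨h.inj, h.exact, h.surj⟩
  refine ⟨fun φ ψ hφ => ?_, fun φ => ⟨fun hφ => ?_, ?_⟩, fun φ => ?_⟩
  · ext x
    obtain ⟨y, rfl⟩ := h.surj x
    exact DFunLike.congr_fun hφ y
  · obtain ⟨v, hv⟩ := h'.exists_desc (show N →ₗ[K] K from φ)
      (LinearMap.ext fun m => DFunLike.congr_fun hφ m)
    exact ⟨v, KDual.ext fun m => LinearMap.congr_fun hv m⟩
  · rintro ⟨ψ, rfl⟩
    ext m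
    exact (congrArg ψ (h.exact.apply_apply_eq_zero m)).trans (map_zero ψ)
  · obtain ⟨ψ, hψ⟩ := LinearMap.dualMap_surjective_of_injective (f := f.restrictScalars K) h.inj
      (show M →ₗ[K] K from φ)
    exact ⟨ψ, KDual.ext fun m => LinearMap.congr_fun hψ m⟩

variable (σ) in
theorem injective_of_projective (M : Type) [AddCommGroup M] [Module A M] [Module.Projective A M] :
    Module.Injective A' (KDual σ M) := by
  refine ⟨fun X Y _ _ _ _ f hf g => ?_⟩
  have hs := (shortExactSeq σ.symm (f := f) (g := (LinearMap.range f).mkQ) ⟨hf, fun y => by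
    simp, Submodule.mkQ_surjective _⟩).surj
  obtain ⟨h, hh⟩ := Module.projective_lifting_property (map σ.symm f) (flip g) hs
  refine ⟨flip h, fun x => ?_⟩
  ext m
  exact DFunLike.congr_fun (LinearMap.congr_fun hh m) x

variable (σ) in
/-- Finitely generated modules embed into duals of free modules. -/
theorem exists_embedding (M : Type) [AddCommGroup M] [Module A M] [FiniteDimensional K A]
    [Module.Finite A M] :
    ∃ (m : ℕ) (ι : M →ₗ[A] KDual σ.symm (Fin m → A')), Function.Injective ι := by
  have := finite σ M
  obtain ⟨m, p, hp⟩ := exists_free_cover (R := A') (KDual σ M)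
  refine ⟨m, flip p, ?_⟩
  rw [injective_iff_map_eq_zero]
  refine fun x hx => eq_zero_of_forall (σ := σ) x fun φ => ?_
  obtain ⟨y, rfl⟩ := hp φ
  exact DFunLike.congr_fun hx y

variable (σ) in
theorem projective_of_injective (M : Type) [AddCommGroup M] [Module A M] [FiniteDimensional K A]
    [FiniteDimensional K A'] [Module.Finite A M] (hM : Module.Injective A M) :
    Module.Projective A' (KDual σ M) := by
  obtain ⟨m, ι, hι⟩ := exists_embedding σ M
  obtain ⟨ρ, hρ⟩ := hM.out ι hι LinearMap.id
  have hρ' : ρ ∘ₗ ι = LinearMap.id := LinearMap.ext hρ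
  have := Module.Projective.of_equiv (evalEquivSymm σ (Fin m → A'))
  exact Module.Projective.of_split (map σ ρ) (map σ ι) (by rw [← map_comp, hρ', map_id])

end KDual

end Duality

section DualityExt

variable {K A A' : Type} [Field K] [Ring A] [Ring A'] [Algebra K A] [Algebra K A']
  (σ : AntiIso K A A')

/-- The duality preserves the vanishing of extension groups. -/
theorem ExtVanish.kdual [FiniteDimensional K A] (M N : Type) [AddCommGroup M] [AddCommGroup N]
    [Module A M] [Module A N] [Module.Finite A M] [Module.Finite A N] {j : ℕ}
    (h : ExtVanish A (j + 1) M N) : ExtVanish A' (j + 1) (KDual σ N) (KDual σ M) := by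
  have : IsNoetherianRing A := IsNoetherianRing.of_finite K A
  induction j generalizing M with
  | zero =>
    obtain ⟨m, p, hp⟩ := exists_free_cover (R := A) M
    refine ExtVanish.one_of_forall_lift (KDual.shortExactSeq σ (ShortExactSeq.ker hp))
      (ExtVanish.of_injective (KDual.injective_of_projective σ _) 0) fun u => ?_
    obtain ⟨f, rfl⟩ := KDual.exists_map_eq u
    obtain ⟨v, rfl⟩ := ExtVanish.exists_extend (ShortExactSeq.ker hp) h f
    exact ⟨KDual.map σ v, rfl⟩
  | succ j ih =>
    obtain ⟨m, p, hp⟩ := exists_free_cover (R := A) M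
    exact ExtVanish.sub_of_shortExact (KDual.shortExactSeq σ (ShortExactSeq.ker hp))
      (ih _ (ExtVanish.left_of_shortExact (ShortExactSeq.ker hp) (ExtVanish.of_projective j) h))
      (ExtVanish.of_injective (KDual.injective_of_projective σ _) _)

theorem GldimLE.of_antiIso (σ : AntiIso K A A') [FiniteDimensional K A]
    [FiniteDimensional K A'] {n : ℕ}
    (h : GldimLE A n) : GldimLE A' n := by
  have : IsNoetherianRing A := IsNoetherianRing.of_finite K A
  have : IsNoetherianRing A' := IsNoetherianRing.of_finite K A'
  rw [gldimLE_iff] at h ⊢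
  intro X Y hX hY
  have hX' := KDual.finite σ.symm X
  have hY' := KDual.finite σ.symm Y
  exact ExtVanish.congr_left (KDual.evalEquivSymm σ X).symm
    (ExtVanish.congr_right (KDual.evalEquivSymm σ Y).symm
      (ExtVanish.kdual σ _ _ (h (ModuleCat.of A (KDual σ.symm Y))
        (ModuleCat.of A (KDual σ.symm X)) hY' hX')))

theorem gldimLE_iff_of_antiIso (σ : AntiIso K A A') [FiniteDimensional K A]
    [FiniteDimensional K A'] {n : ℕ} :
    GldimLE A n ↔ GldimLE A' n :=
  ⟨fun h => h.of_antiIso σ, fun h => h.of_antiIso σ.symm⟩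

/-- Global dimension is left-right symmetric for finite-dimensional algebras. -/
theorem gldimLE_op_iff_of_ringEquiv (K : Type) [Field K] {S S' : Type} [Ring S] [Ring S']
    [Algebra K S] [FiniteDimensional K S] (ρ : S ≃+* S') {n : ℕ} :
    GldimLE Sᵐᵒᵖ n ↔ GldimLE S' n := by
  let : Algebra K S' := ((ρ : S →+* S').comp (algebraMap K S)).toAlgebra' fun c x => by
    obtain ⟨y, rfl⟩ := ρ.surjective x
    change ρ (algebraMap K S c) * ρ y = ρ y * ρ (algebraMap K S c)
    rw [← map_mul, ← map_mul, Algebra.commutes]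
  let e : S ≃ₗ[K] S' :=
    { ρ with
      map_smul' := fun c x => by
        change ρ (c • x) = c • ρ x
        rw [Algebra.smul_def, Algebra.smul_def, map_mul]
        rfl }
  have : FiniteDimensional K S' := Module.Finite.equiv e
  have : FiniteDimensional K Sᵐᵒᵖ := Module.Finite.equiv (MulOpposite.opLinearEquiv K)
  exact gldimLE_iff_of_antiIso (K := K)
    { toFun := fun a => ρ a.unop
      invFun := fun b => MulOpposite.op (ρ.symm b)
      left_inv := fun a => by simp
      right_inv := fun b => by simp
      map_add := fun a b => by simp
      map_mul := fun a b => by simp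
      map_algebraMap := fun c => rfl }

/-- The dual of an isomorphism. -/
def KDual.mapEquiv {M N : Type} [AddCommGroup M] [AddCommGroup N] [Module A M] [Module A N]
    (e : M ≃ₗ[A] N) : KDual σ N ≃ₗ[A'] KDual σ M :=
  { KDual.map σ e.toLinearMap with
    invFun := KDual.map σ e.symm.toLinearMap
    left_inv := fun φ => KDual.ext fun m => congrArg φ (e.apply_symm_apply m)
    right_inv := fun φ => KDual.ext fun m => congrArg φ (e.symm_apply_apply m) }

/-- Dualizing an exact sequence. -/
theorem SeqOf.kdual {𝒳 : ModuleCat.{0} A → Prop} {𝒵 : ModuleCat.{0} A' → Prop}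
    (h𝒳 : ∀ X, 𝒳 X → 𝒵 (ModuleCat.of A' (KDual σ X))) {k : ℕ} {X M : ModuleCat.{0} A}
    (h : SeqOf 𝒳 k X M) :
    SeqOf 𝒵 k (ModuleCat.of A' (KDual σ M)) (ModuleCat.of A' (KDual σ X)) := by
  induction k generalizing X with
  | zero =>
    obtain ⟨e⟩ := h
    exact ⟨KDual.mapEquiv σ e⟩
  | succ k ih =>
    obtain ⟨t, X', f, g, ht, hfg, h'⟩ := h
    exact (ih h').snoc (h𝒳 t ht) (KDual.shortExactSeq σ hfg)

theorem MemAdd.kdual {X M : ModuleCat.{0} A} (h : MemAdd X M) :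
    MemAdd (ModuleCat.of A' (KDual σ X)) (ModuleCat.of A' (KDual σ M)) := by
  obtain ⟨n, a, b, h⟩ := memAdd_iff.1 h
  refine memAdd_iff.2 ⟨n, fun i => KDual.map σ (b i), fun i => KDual.map σ (a i), ?_⟩
  refine LinearMap.ext fun (φ : KDual σ M) => KDual.ext (σ := σ) fun m => ?_
  have := congrArg φ (LinearMap.congr_fun h m)
  rw [LinearMap.sum_apply, map_sum] at this
  rw [LinearMap.sum_apply]
  refine Eq.trans ?_ this
  let ev : KDual σ M →+ K :=
    { toFun := fun ψ => ψ m, map_zero' := rfl, map_add' := fun _ _ => rfl }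
  exact map_sum ev _ _

theorem ProjInj.kdual [FiniteDimensional K A] [FiniteDimensional K A'] {M : ModuleCat.{0} A}
    (hfin : Module.Finite A M) (h : ProjInj M) : ProjInj (ModuleCat.of A' (KDual σ M)) :=
  have := h.1
  ⟨KDual.projective_of_injective σ M h.2, KDual.injective_of_projective σ M⟩

/-- The duality induces an anti-isomorphism of endomorphism rings. -/
noncomputable def endDualEquiv [FiniteDimensional K A] (M : Type) [AddCommGroup M] [Module A M]
    [Module.Finite A M] : Module.End A M ≃+* (Module.End A' (KDual σ M))ᵐᵒᵖ :=
  RingEquiv.ofBijective (F := Module.End A M →+* (Module.End A' (KDual σ M))ᵐᵒᵖ)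
    { toFun := fun f => MulOpposite.op (KDual.map σ f)
      map_one' := rfl
      map_mul' := fun _ _ => rfl
      map_zero' := by
        rw [← MulOpposite.op_zero]
        exact congrArg _ (LinearMap.ext fun φ => KDual.ext fun m => map_zero φ)
      map_add' := fun f g => by rw [KDual.map_add, MulOpposite.op_add] }
    ⟨fun _ _ h => KDual.map_injective (MulOpposite.op_injective h), fun g => by
      obtain ⟨f, hf⟩ := KDual.exists_map_eq g.unop
      exact ⟨f, congrArg MulOpposite.op hf⟩⟩

/-- The canonical anti-isomorphism from an algebra to its opposite. -/
def AntiIso.op (K A : Type) [Field K] [Ring A] [Algebra K A] : AntiIso K A Aᵐᵒᵖ where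
  toFun := MulOpposite.op
  invFun := MulOpposite.unop
  left_inv _ := rfl
  right_inv _ := rfl
  map_add _ _ := rfl
  map_mul _ _ := rfl
  map_algebraMap _ := rfl

/-- The module `Dreg` is the dual of the regular module of the opposite algebra. -/
def dregEquiv (K A : Type) [Field K] [Ring A] [Algebra K A] :
    Dreg K A ≃ₗ[A] KDual (AntiIso.op K A).symm (reg Aᵐᵒᵖ) where
  toFun φ := KDual.mk _
    { toFun := fun x => (show A →ₗ[K] K from φ) (MulOpposite.unop x)
      map_zero' := (show A →ₗ[K] K from φ).map_zero
      map_add' := fun x y => (show A →ₗ[K] K from φ).map_add _ _ } fun c x => by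
        refine Eq.trans (congrArg (show A →ₗ[K] K from φ) ?_)
          ((show A →ₗ[K] K from φ).map_smul c (MulOpposite.unop x))
        exact (Algebra.commutes c (MulOpposite.unop x)).symm.trans
          (Algebra.smul_def c (MulOpposite.unop x)).symm
  invFun ψ := show A →ₗ[K] K from
    { toFun := fun a => ψ (MulOpposite.op a)
      map_add' := fun x y => map_add ψ _ _
      map_smul' := fun c x => by
        refine Eq.trans (congrArg ψ ?_)
          (KDual.map_algebraMap_smul ψ c (MulOpposite.op x : Aᵐᵒᵖ))
        exact congrArg MulOpposite.op ((Algebra.smul_def c x).trans (Algebra.commutes c x)) }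
  left_inv _ := rfl
  right_inv _ := rfl
  map_add' _ _ := rfl
  map_smul' _ _ := rfl

/-- The dual of `Dreg` is the regular module of the opposite algebra. -/
noncomputable def regOpEquiv (K A : Type) [Field K] [Ring A] [Algebra K A]
    [FiniteDimensional K A] : reg Aᵐᵒᵖ ≃ₗ[Aᵐᵒᵖ] KDual (AntiIso.op K A) (Dreg K A) :=
  have : Module.Finite Aᵐᵒᵖ (reg Aᵐᵒᵖ) := inferInstanceAs (Module.Finite Aᵐᵒᵖ Aᵐᵒᵖ)
  have : FiniteDimensional K Aᵐᵒᵖ := Module.Finite.equiv (MulOpposite.opLinearEquiv K)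
  (KDual.evalEquivSymm (AntiIso.op K A) (reg Aᵐᵒᵖ)).trans
    (KDual.mapEquiv (AntiIso.op K A) (dregEquiv K A))

end DualityExt

section LowerBound

variable {Γ : Type} [Ring Γ]

/-- Over a finite-dimensional algebra, a finitely generated module embeds into a finitely
generated injective module. -/
theorem exists_injective_shortExactSeq (K : Type) [Field K] [Algebra K Γ]
    [FiniteDimensional K Γ] (M : ModuleCat.{0} Γ) (hM : Module.Finite Γ M) :
    ∃ (m : ℕ) (N : ModuleCat.{0} Γ)
      (f : M →ₗ[Γ] KDual (AntiIso.op K Γ).symm (Fin m → Γᵐᵒᵖ))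
      (g : KDual (AntiIso.op K Γ).symm (Fin m → Γᵐᵒᵖ) →ₗ[Γ] N),
      ShortExactSeq f g ∧ Module.Finite Γ N := by
  have : FiniteDimensional K Γᵐᵒᵖ := Module.Finite.equiv (MulOpposite.opLinearEquiv K)
  obtain ⟨m, ι, hι⟩ := KDual.exists_embedding (AntiIso.op K Γ) M
  have := KDual.finite (AntiIso.op K Γ).symm (Fin m → Γᵐᵒᵖ)
  exact ⟨m, ModuleCat.of Γ (_ ⧸ LinearMap.range ι), ι, (LinearMap.range ι).mkQ,
    ⟨hι, fun y => by simp, Submodule.mkQ_surjective _⟩,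
    (inferInstance : Module.Finite Γ (_ ⧸ LinearMap.range ι))⟩

attribute [local instance] homModule

/-- The global dimension of `Γ` exceeds that of the shifted algebra by at most the projective
dimension of the tilting module. -/
theorem gldimLE_of_gldimLE_endOp (K : Type) [Field K] [Algebra K Γ] [FiniteDimensional K Γ]
    {T t : ModuleCat.{0} Γ} {k : ℕ} (hfin : Module.Finite Γ T)
    (hTT : ∀ i, ExtVanish Γ (i + 1) T T) (ht : MemAdd T t)
    (hs : SeqOf (MemAdd T) k (reg Γ) t)
    (hpd : ∀ L : ModuleCat.{0} Γ, Module.Finite Γ L → ∀ j, k < j → ExtVanish Γ j T L)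
    {g : ℕ} (hB : GldimLE (Module.End Γ T)ᵐᵒᵖ g) : GldimLE Γ (g + k) := by
  have : IsNoetherianRing Γ := IsNoetherianRing.of_finite K Γ
  have : FiniteDimensional K Γᵐᵒᵖ := Module.Finite.equiv (MulOpposite.opLinearEquiv K)
  have hperp : ∀ L : ModuleCat.{0} Γ, Module.Finite Γ L → ∀ N : ModuleCat.{0} Γ,
      Module.Finite Γ N → (∀ i, ExtVanish Γ (i + 1) T N) → ∀ j, g + k < j →
      ExtVanish Γ j N L := by
    intro L hL N hN hTN j hj
    obtain ⟨r, N', f, p, hfp, -, -, hp⟩ := exists_perp_cover K hfin hTT ht hs N hN hTN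
    have := finite_hom_pi (Γ := Γ) T r
    have hHom : Module.Finite (Module.End Γ T)ᵐᵒᵖ (T →ₗ[Γ] N) :=
      Module.Finite.of_surjective (homMap T p) hp
    exact extVanish_of_homModule K hfin hTT ht hs (hpd L hL) g N hN hTN
      (fun X => (hB (ModuleCat.of _ (T →ₗ[Γ] N)) hHom).extVanish X (Nat.lt_succ_self g)) j hj
  have key : ∀ L : ModuleCat.{0} Γ, Module.Finite Γ L → ∀ m, ∀ N : ModuleCat.{0} Γ,
      Module.Finite Γ N → (∀ i, m ≤ i → ExtVanish Γ (i + 1) T N) → ∀ j, g + k < j →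
      ExtVanish Γ j N L := by
    intro L hL m
    induction m with
    | zero => exact fun N hN hTN => hperp L hL N hN fun i => hTN i i.zero_le
    | succ m ih =>
      intro N hN hTN j hj
      obtain ⟨r, N', f, p, hfp, hN'⟩ := exists_injective_shortExactSeq K N hN
      have hE := KDual.injective_of_projective (AntiIso.op K Γ).symm (Fin r → Γᵐᵒᵖ)
      have hEfin := KDual.finite (AntiIso.op K Γ).symm (Fin r → Γᵐᵒᵖ)
      refine ExtVanish.left_of_shortExact hfp
        (hperp L hL (ModuleCat.of Γ (KDual (AntiIso.op K Γ).symm (Fin r → Γᵐᵒᵖ))) hEfin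
          (fun i => ExtVanish.of_injective hE i) j hj)
        (ih N' hN' (fun i hi => ?_) (j + 1) (by omega))
      exact ExtVanish.quot_of_shortExact hfp (ExtVanish.of_injective hE i)
        (hTN (i + 1) (by omega))
  rw [gldimLE_iff]
  exact fun M N hM hN => key N hN k M hM (fun i hi => hpd M hM _ (by omega)) _ (by omega)

/-- The bounds on the global dimension of the endomorphism algebra of a special tilting
module. -/
theorem gldim_endOp_bounds (K : Type) [Field K] [Algebra K Γ] [FiniteDimensional K Γ]
    {P T t : ModuleCat.{0} Γ} {k n : ℕ} (hTfin : Module.Finite Γ T)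
    (hPfin : Module.Finite Γ P) (hP : ProjInj P) (hTT : ∀ i, ExtVanish Γ (i + 1) T T)
    (ht : MemAdd T t) (hs : SeqOf (fun X => MemAdd P X ∧ MemAdd T X) k (reg Γ) t)
    (hpd : ∀ L : ModuleCat.{0} Γ, Module.Finite Γ L → ∀ j, k < j → ExtVanish Γ j T L)
    (hgl : GldimEq Γ n) (hkn : k ≤ n) :
    GldimLE (Module.End Γ T)ᵐᵒᵖ n ∧ ∀ g, GldimLE (Module.End Γ T)ᵐᵒᵖ g → n ≤ g + k :=
  ⟨gldimLE_endOp K hTfin hPfin hP hTT ht hs hgl.1 hkn, fun _ hg => hgl.2 _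
    (gldimLE_of_gldimLE_endOp K hTfin hTT ht (hs.mono fun _ hX => hX.2) hpd hg)⟩

end LowerBound

section SelfInjective

variable {Γ : Type} [Ring Γ]

/-- If `A` has injective dimension less than the length of a coresolution by finitely generated
projective-injective modules, then `A` is itself projective-injective. -/
theorem projInj_of_seqOf {A t : ModuleCat.{0} Γ} {k n : ℕ}
    (hs : SeqOf (fun X => ProjInj X ∧ Module.Finite Γ X) k A t) (hnk : n < k)
    (hA : ∀ M : ModuleCat.{0} Γ, Module.Finite Γ M → ExtVanish Γ (n + 1) M A) : ProjInj A := by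
  induction n generalizing A k with
  | zero =>
    obtain ⟨k, rfl⟩ : ∃ i, k = i + 1 := ⟨k - 1, by omega⟩
    obtain ⟨E, A', f, g, ⟨hE, hEfin⟩, hfg, -⟩ := hs
    obtain ⟨v, hv⟩ := ExtVanish.exists_extend hfg
      (hA A' (Module.Finite.of_surjective g hfg.surj)) LinearMap.id
    exact IsSummand.projInj hE ⟨f, v, hv⟩
  | succ n ih =>
    obtain ⟨k, rfl⟩ : ∃ i, k = i + 1 := ⟨k - 1, by omega⟩
    obtain ⟨E, A', f, g, ⟨hE, hEfin⟩, hfg, hs'⟩ := hs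
    have hA' : ProjInj A' := ih hs' (by omega) fun M hM =>
      ExtVanish.quot_of_shortExact hfg (ExtVanish.of_injective hE.2 n) (hA M hM)
    have := hA'.1
    obtain ⟨v, hv⟩ := ExtVanish.exists_extend hfg (ExtVanish.of_projective 0) LinearMap.id
    exact IsSummand.projInj hE ⟨f, v, hv⟩

/-- Self-injective algebras have infinite dominant dimension. -/
theorem domdimGE_of_injective (h : Module.Injective Γ (reg Γ)) (k : ℕ) : DomdimGE Γ k := by
  let Y : ℕ → ModuleCat.{0} Γ := fun i => Nat.casesOn i (reg Γ) fun _ => ModuleCat.of Γ PUnit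
  refine ⟨Y, LinearMap.id, fun _ => 0, Function.injective_id, fun x => ?_, fun i x => ?_,
    fun i => ?_, fun i _ => ?_⟩
  · simp
  · have hne : ∀ M : ModuleCat.{0} Γ, Nonempty M := fun M => ⟨0⟩
    obtain ⟨y⟩ := hne (Y i)
    exact iff_of_true (Subsingleton.elim (α := PUnit) _ _)
      ⟨y, Subsingleton.elim (α := PUnit) _ _⟩
  · cases i with
    | zero => exact h
    | succ i => exact ⟨fun _ _ _ _ _ _ _ _ _ => ⟨0, fun _ => Subsingleton.elim (α := PUnit) _ _⟩⟩
  · cases i with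
    | zero => exact (inferInstance : Module.Projective Γ Γ)
    | succ i => exact (inferInstance : Module.Projective Γ PUnit)

/-- If the opposite algebra is self-injective and `Γ` has finite global dimension, then `Γ` is
self-injective. -/
theorem projInj_reg_of_op (K : Type) [Field K] [Algebra K Γ] [FiniteDimensional K Γ] {n : ℕ}
    (hgl : GldimLE Γ n) (h : ProjInj (reg Γᵐᵒᵖ)) : ProjInj (reg Γ) := by
  have : FiniteDimensional K Γᵐᵒᵖ := Module.Finite.equiv (MulOpposite.opLinearEquiv K)
  have hE : ∀ m, ProjInj (ModuleCat.of Γ (KDual (AntiIso.op K Γ).symm (Fin m → Γᵐᵒᵖ))) :=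
    fun m => ProjInj.kdual (M := ModuleCat.of _ (Fin m → Γᵐᵒᵖ)) (AntiIso.op K Γ).symm
      (inferInstance : Module.Finite Γᵐᵒᵖ (Fin m → Γᵐᵒᵖ))
      ⟨(inferInstance : Module.Projective Γᵐᵒᵖ (Fin m → Γᵐᵒᵖ)), injective_pi h.2 m⟩
  have hseq : ∀ k (M : ModuleCat.{0} Γ), Module.Finite Γ M →
      ∃ t, SeqOf (fun X => ProjInj X ∧ Module.Finite Γ X) k M t := by
    intro k
    induction k with
    | zero => exact fun M _ => ⟨M, ⟨LinearEquiv.refl Γ M⟩⟩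
    | succ k ih =>
      intro M hM
      obtain ⟨m, N, f, g, hfg, hN⟩ := exists_injective_shortExactSeq K M hM
      obtain ⟨t, ht⟩ := ih N hN
      exact ⟨t, ModuleCat.of Γ (KDual (AntiIso.op K Γ).symm (Fin m → Γᵐᵒᵖ)), N, f, g,
        ⟨hE m, KDual.finite _ _⟩, hfg, ht⟩
  obtain ⟨t, ht⟩ := hseq (n + 1) (reg Γ) (inferInstance : Module.Finite Γ Γ)
  exact projInj_of_seqOf ht (Nat.lt_succ_self n) fun M hM =>
    (hgl M hM).extVanish _ (Nat.lt_succ_self n)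

end SelfInjective

section Main

variable {Γ : Type} [Ring Γ]

theorem le_of_seqOf {P T t : ModuleCat.{0} Γ} {k n : ℕ} (hPfin : Module.Finite Γ P)
    (hP : ProjInj P) (hs : SeqOf (fun X => MemAdd P X ∧ MemAdd T X) k (reg Γ) t)
    (hgl : GldimLE Γ n) (hreg : ¬ ProjInj (reg Γ)) : k ≤ n := by
  by_contra! hnk
  exact hreg (projInj_of_seqOf (hs.mono fun X hX => ⟨hX.1.projInj hP, hX.1.finite hPfin⟩) hnk
    fun M hM => (hgl M hM).extVanish _ (Nat.lt_succ_self n))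

/-- The bounds for special tilting modules. -/
theorem IsSpecialTilting.gldim_bounds (K : Type) [Field K] [Algebra K Γ] [FiniteDimensional K Γ]
    {P T : ModuleCat.{0} Γ} {k n : ℕ} (hPfin : Module.Finite Γ P) (hP : ProjInj P)
    (hT : IsSpecialTilting P k T) (hgl : GldimEq Γ n) (hreg : ¬ ProjInj (reg Γ)) :
    GldimLE (Module.End Γ T)ᵐᵒᵖ n ∧ ∀ g, GldimLE (Module.End Γ T)ᵐᵒᵖ g → n ≤ g + k := by
  obtain ⟨⟨hTfin, hpd, hTT, -⟩, Y, f, hex, hY0, hYT, hYP⟩ := hT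
  have hs := seqOf_of_isExactSeq (𝒳 := fun X => MemAdd P X ∧ MemAdd T X) hex
    fun i h1 h2 => ⟨hYP i h1 h2, hYT i h1 (by omega)⟩
  rw [hY0] at hs
  exact gldim_endOp_bounds K hTfin hPfin hP
    (fun i => extVanish_of_extZero (hTT (i + 1) (by omega))) (hYT (k + 1) (by omega) le_rfl) hs
    (fun L _ j hj => hpd.extVanish L hj) hgl (le_of_seqOf hPfin hP hs hgl.1 hreg)

/-- The bounds for special cotilting modules. -/
theorem IsSpecialCotilting.gldim_bounds {K : Type} [Field K] [Algebra K Γ]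
    [FiniteDimensional K Γ] {P C : ModuleCat.{0} Γ} {k n : ℕ} (hPfin : Module.Finite Γ P)
    (hP : ProjInj P) (hC : IsSpecialCotilting K P k C) (hgl : GldimEq Γ n)
    (hreg : ¬ ProjInj (reg Γ)) :
    GldimLE (Module.End Γ C)ᵐᵒᵖ n ∧ ∀ g, GldimLE (Module.End Γ C)ᵐᵒᵖ g → n ≤ g + k := by
  obtain ⟨⟨hCfin, hid, hCC, -⟩, Y, f, hex, hYk, hYC, hYP⟩ := hC
  have hs := seqOf_of_isExactSeq (𝒳 := fun X => MemAdd P X ∧ MemAdd C X) hex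
    fun i h1 h2 => ⟨hYP i h1 h2, hYC i h2⟩
  rw [hYk] at hs
  have : FiniteDimensional K Γᵐᵒᵖ := Module.Finite.equiv (MulOpposite.opLinearEquiv K)
  let σ := AntiIso.op K Γ
  have hgl' : GldimEq Γᵐᵒᵖ n :=
    ⟨hgl.1.of_antiIso σ, fun m hm => hgl.2 m (hm.of_antiIso σ.symm)⟩
  have hs' := (hs.kdual σ (𝒵 := fun X => MemAdd (ModuleCat.of Γᵐᵒᵖ (KDual σ P)) X ∧
    MemAdd (ModuleCat.of Γᵐᵒᵖ (KDual σ C)) X)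
    fun X hX => ⟨hX.1.kdual σ, hX.2.kdual σ⟩).congr_left (regOpEquiv K Γ)
  have hP' : ProjInj (ModuleCat.of Γᵐᵒᵖ (KDual σ P)) := hP.kdual σ hPfin
  have hPfin' : Module.Finite Γᵐᵒᵖ (KDual σ P) := KDual.finite σ P
  have hkn : k ≤ n := le_of_seqOf hPfin' hP' hs' hgl'.1
    fun h => hreg (projInj_reg_of_op K hgl.1 h)
  have hiff : ∀ m, GldimLE (Module.End Γ C)ᵐᵒᵖ m ↔
      GldimLE (Module.End Γᵐᵒᵖ (KDual σ C))ᵐᵒᵖ m := by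
    intro m
    let : Module K C := Module.compHom C (algebraMap K Γ)
    have : IsScalarTower K Γ C := isScalarTower_compHom K Γ C
    have : SMulCommClass Γ K C := IsScalarTower.to_smulCommClass'
    have : FiniteDimensional K (Module.End Γ C) := finite_end K C
    exact gldimLE_op_iff_of_ringEquiv K (endDualEquiv σ C)
  simp only [hiff]
  refine gldim_endOp_bounds K (T := ModuleCat.of Γᵐᵒᵖ (KDual σ C)) (KDual.finite σ C) hPfin' hP'
    (fun i => ExtVanish.kdual σ _ _ (extVanish_of_extZero (hCC (i + 1) (by omega))))
    ((hYC 0 k.zero_le).kdual σ) hs' (fun L hL j hj => ?_) hgl' hkn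
  obtain ⟨j, rfl⟩ : ∃ i, j = i + 1 := ⟨j - 1, by omega⟩
  have hL' := KDual.finite σ.symm L
  exact ExtVanish.congr_right (KDual.evalEquivSymm σ L).symm
    (ExtVanish.kdual σ _ _ (hid.extVanish (ModuleCat.of Γ (KDual σ.symm L)) hj))

theorem IsMaxProjInjSummand.finite {P : ModuleCat.{0} Γ} (h : IsMaxProjInjSummand P) :
    Module.Finite Γ P :=
  ((MemAdd.refl (reg Γ)).of_summand h.1).finite (inferInstance : Module.Finite Γ Γ)

end Main

end PS

open PS in
/-- Corollary `gldim-bound`.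
Let `Γ` be finite-dimensional with `gldim Γ = n < ∞` and `domdim Γ = d`.  For `0 ≤ k ≤ d`, the
`k`-shifted algebra `B_k = End_Γ(T_k)ᵒᵖ` satisfies `gldim Γ - k ≤ gldim B_k ≤ gldim Γ`, and
dually the `k`-coshifted algebra `B^k = End_Γ(C^k)ᵒᵖ` satisfies the same bounds. -/
theorem statement7 (K : Type) [Field K] (Γ : Type) [Ring Γ] [Algebra K Γ]
    [FiniteDimensional K Γ] (hbasic : IsBasic (reg Γ)) (n d k : ℕ)
    (hgl : GldimEq Γ n) (hdom : DomdimEq Γ d) (hk : k ≤ d)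
    (Pii : ModuleCat.{0} Γ) (hPii : IsMaxProjInjSummand Pii) :
    (∀ Tk : ModuleCat.{0} Γ, IsBasic Tk → IsSpecialTilting Pii k Tk →
      GldimLE ((Module.End Γ Tk)ᵐᵒᵖ) n ∧
      (∀ g : ℕ, GldimLE ((Module.End Γ Tk)ᵐᵒᵖ) g → n ≤ g + k)) ∧
    (∀ Ck : ModuleCat.{0} Γ, IsBasic Ck → IsSpecialCotilting K Pii k Ck →
      GldimLE ((Module.End Γ Ck)ᵐᵒᵖ) n ∧
      (∀ g : ℕ, GldimLE ((Module.End Γ Ck)ᵐᵒᵖ) g → n ≤ g + k)) := by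
  have hreg : ¬ ProjInj (reg Γ) := fun h => hdom.2 (domdimGE_of_injective h.2 _)
  exact ⟨fun _ _ hT => hT.gldim_bounds K hPii.finite hPii.2.1 hgl hreg,
    fun _ _ hC => hC.gldim_bounds hPii.finite hPii.2.1 hgl hreg⟩
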